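/- arXiv:1704.01958 — 9 statements merged into one kernel-verified Lean document; each statement's English description precedes it below -/
import Mathlib

section
/- Let s (respectively r) be the number of ℝ-algebra homomorphisms ρ : E^σ → ℝ that are ramified in E and satisfy ρ(λ) > 0 (respectively ρ(λ) < 0). Then the real quadratic form q_{E,λ} on E has signature (n + s − r, n + r − s); that is, q_{E,λ} is isometric to a diagonal quadratic form over ℝ with exactly n + s − r coefficients equal to +1 and n + r − s coefficients equal to −1. -/
universe u

/-- The trace of a finite product of finite free algebras is the sum of the traces. -/
theorem Algebra.trace_pi_eq_sum {R ι : Type*} [CommRing R] [Fintype ι] {A : ι → Type*}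
    [∀ i, CommRing (A i)] [∀ i, Algebra R (A i)] [∀ i, Module.Free R (A i)]
    [∀ i, Module.Finite R (A i)] (x : ∀ i, A i) :
    Algebra.trace R (∀ i, A i) x = ∑ i, Algebra.trace R (A i) (x i) := by
  classical
  rw [Algebra.trace_eq_matrix_trace (Pi.basis fun i => Module.Free.chooseBasis R (A i))]
  simp_rw [Algebra.trace_eq_matrix_trace (Module.Free.chooseBasis R (A _)), Matrix.trace,
    Matrix.diag, Algebra.leftMulMatrix_eq_repr_mul, Fintype.sum_sigma]
  refine Finset.sum_congr rfl fun i _ => Finset.sum_congr rfl fun j _ => ?_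
  simp [Pi.basis_repr, Pi.basis_apply]

/-- Algebra homomorphisms to the base field are determined by their kernels. -/
theorem AlgHom.eq_of_ker_le {K A : Type*} [Field K] [CommRing A] [Algebra K A]
    {φ ψ : A →ₐ[K] K} (h : RingHom.ker φ ≤ RingHom.ker ψ) : φ = ψ := by
  ext x
  have hx : x - algebraMap K A (φ x) ∈ RingHom.ker ψ := h (by simp [RingHom.mem_ker])
  have hx' : ψ x = φ x := by simpa [RingHom.mem_ker, sub_eq_zero] using hx
  exact hx'.symm

theorem AlgHom.ker_isMaximal_of_field {K A : Type*} [Field K] [CommRing A] [Algebra K A]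
    (φ : A →ₐ[K] K) : (RingHom.ker φ).IsMaximal :=
  RingHom.ker_isMaximal_of_surjective φ fun c => ⟨algebraMap K A c, by simp⟩

/-- A finite reduced real algebra is a product of copies of `ℝ`, indexed by its real points, and
of copies of `ℂ`. -/
theorem Real.exists_algEquiv_prod (F : Type u) [CommRing F] [Algebra ℝ F] [FiniteDimensional ℝ F]
    [IsReduced F] :
    Finite (F →ₐ[ℝ] ℝ) ∧ ∃ (κ : Type u) (_ : Finite κ)
      (e : F ≃ₐ[ℝ] ((F →ₐ[ℝ] ℝ) → ℝ) × (κ → ℂ)), ∀ x ρ, (e x).1 ρ = ρ x := by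
  classical
  have : IsArtinianRing F := IsArtinianRing.of_finite ℝ F
  let toMax : (F →ₐ[ℝ] ℝ) → MaximalSpectrum F :=
    fun ρ => ⟨RingHom.ker ρ, ρ.ker_isMaximal_of_field⟩
  have hinj : Function.Injective toMax := fun ρ ρ' h =>
    AlgHom.eq_of_ker_le (congrArg MaximalSpectrum.asIdeal h).le
  have hfin : Finite (F →ₐ[ℝ] ℝ) := Finite.of_injective _ hinj
  refine ⟨hfin, {m : MaximalSpectrum F // Nonempty ((F ⧸ m.asIdeal) ≃ₐ[ℝ] ℂ)}, inferInstance, ?_⟩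
  have hsplit (m : MaximalSpectrum F) :
      Nonempty ((F ⧸ m.asIdeal) ≃ₐ[ℝ] ℂ) ∨ ∃ ρ, toMax ρ = m := by
    let := Ideal.Quotient.field m.asIdeal
    obtain ⟨⟨e⟩⟩ | ⟨⟨e⟩⟩ := Real.nonempty_algEquiv_or (F ⧸ m.asIdeal)
    · refine .inr ⟨e.toAlgHom.comp (Ideal.Quotient.mkₐ ℝ m.asIdeal), MaximalSpectrum.ext ?_⟩
      ext x
      simp [toMax, RingHom.mem_ker, Ideal.Quotient.eq_zero_iff_mem]
    · exact .inl ⟨e⟩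
  have hnot (ρ : F →ₐ[ℝ] ℝ) : ¬ Nonempty ((F ⧸ (toMax ρ).asIdeal) ≃ₐ[ℝ] ℂ) := by
    rintro ⟨e⟩
    let ψ : ℂ →ₐ[ℝ] ℝ := (Ideal.Quotient.liftₐ (RingHom.ker ρ) ρ fun a ha => ha).comp
      e.symm.toAlgHom
    have h : ψ Complex.I * ψ Complex.I = -1 := by rw [← map_mul]; simp
    nlinarith [mul_self_nonneg (ψ Complex.I)]
  let f : F →ₐ[ℝ] ((F →ₐ[ℝ] ℝ) → ℝ) ×
      ({m : MaximalSpectrum F // Nonempty ((F ⧸ m.asIdeal) ≃ₐ[ℝ] ℂ)} → ℂ) :=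
    (AlgHom.pi fun ρ => ρ).prod
      (AlgHom.pi fun m => m.2.some.toAlgHom.comp (Ideal.Quotient.mkₐ ℝ m.1.asIdeal))
  have hf1 (x ρ) : (f x).1 ρ = ρ x := rfl
  have hf2 (x m) : (f x).2 m = m.2.some (Ideal.Quotient.mk m.1.asIdeal x) := rfl
  refine ⟨AlgEquiv.ofBijective f ⟨?_, ?_⟩, hf1⟩
  · refine (injective_iff_map_eq_zero f).2 fun x hx => ?_
    refine (IsArtinianRing.equivPi F).injective (funext fun m => ?_)
    rw [IsArtinianRing.equivPi_apply, map_zero, Pi.zero_apply]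
    obtain hm | ⟨ρ, rfl⟩ := hsplit m
    · have := hf2 x ⟨m, hm⟩
      rw [hx] at this
      simpa using this.symm
    · refine Ideal.Quotient.eq_zero_iff_mem.2 ?_
      change ρ x = 0
      rw [← hf1, hx]
      rfl
  · rintro ⟨a, b⟩
    obtain ⟨x, hx⟩ := (IsArtinianRing.equivPi F).surjective fun m =>
      if h : Nonempty ((F ⧸ m.asIdeal) ≃ₐ[ℝ] ℂ) then h.some.symm (b ⟨m, h⟩)
      else algebraMap ℝ _ (a ((hsplit m).resolve_left h).choose)
    have hx' (m) := congrFun hx m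
    refine ⟨x, Prod.ext (funext fun ρ => ?_) (funext fun m => ?_)⟩
    · have h := hx' (toMax ρ)
      rw [dif_neg (hnot ρ), hinj ((hsplit (toMax ρ)).resolve_left (hnot ρ)).choose_spec,
        IsArtinianRing.equivPi_apply] at h
      have h' : x - algebraMap ℝ F (a ρ) ∈ RingHom.ker ρ :=
        Ideal.Quotient.eq.1 (h.trans rfl)
      rw [hf1]
      simpa [RingHom.mem_ker, sub_eq_zero] using h'
    · have h := hx' m.1
      rw [dif_pos m.2, IsArtinianRing.equivPi_apply] at h
      rw [hf2]
      exact (congrArg _ h).trans (AlgEquiv.apply_symm_apply _ _)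

/-- The trace form `f ↦ Tr (μ f ^ 2)` of a finite reduced real algebra is diagonal with one
coefficient `sign (ρ μ)` for every real point `ρ` and a hyperbolic plane for every complex place. -/
theorem Real.exists_diagonalization_traceForm (F : Type u) [CommRing F] [Algebra ℝ F]
    [FiniteDimensional ℝ F] [IsReduced F] [Fintype (F →ₐ[ℝ] ℝ)] :
    ∃ (κ : Type u) (_ : Fintype κ),
      Fintype.card (F →ₐ[ℝ] ℝ) + 2 * Fintype.card κ = Module.finrank ℝ F ∧
      ∀ μ : F, IsUnit μ → ∃ L : F ≃ₗ[ℝ] ((F →ₐ[ℝ] ℝ) ⊕ κ ⊕ κ → ℝ), ∀ f,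
        Algebra.trace ℝ F (μ * f ^ 2) = ∑ j, Sum.elim (fun ρ : F →ₐ[ℝ] ℝ => Real.sign (ρ μ))
          (Sum.elim (fun _ => 1) fun _ => -1) j * L f j ^ 2 := by
  obtain ⟨-, κ, hκ, e, he⟩ := Real.exists_algEquiv_prod F
  have := Fintype.ofFinite κ
  have hrank : Fintype.card (F →ₐ[ℝ] ℝ) + 2 * Fintype.card κ = Module.finrank ℝ F := by
    rw [e.toLinearEquiv.finrank_eq, Module.finrank_prod, Module.finrank_fintype_fun_eq_card,
      Module.finrank_pi_fintype]
    simp [mul_comm]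
  refine ⟨κ, this, hrank, fun μ hμ => ?_⟩
  have hρ (ρ : F →ₐ[ℝ] ℝ) : ρ μ ≠ 0 := (hμ.map ρ).ne_zero
  have hk (k : κ) : (e μ).2 k ≠ 0 :=
    (hμ.map (((Pi.evalAlgHom ℝ (fun _ : κ => ℂ) k).comp (AlgHom.snd ℝ _ _)).comp
      e.toAlgHom)).ne_zero
  choose c hc using fun k : κ => IsAlgClosed.exists_pow_nat_eq (2 * (e μ).2 k) (n := 2) two_pos
  have hc0 (k : κ) : c k ≠ 0 := fun h => hk k (by simpa [h] using hc k)
  let L : F →ₗ[ℝ] ((F →ₐ[ℝ] ℝ) ⊕ κ ⊕ κ → ℝ) :=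
    { toFun := fun f => Sum.elim (fun ρ => √|ρ μ| * ρ f)
        (Sum.elim (fun k => (c k * (e f).2 k).re) fun k => (c k * (e f).2 k).im)
      map_add' := fun f g => by
        ext (ρ | k | k) <;> simp <;> ring
      map_smul' := fun t f => by
        ext (ρ | k | k) <;> simp <;> ring }
  have hL : Function.Injective L := by
    refine (injective_iff_map_eq_zero L).2 fun f hf => e.injective ?_
    rw [map_zero]
    refine Prod.ext (funext fun ρ => ?_) (funext fun k => ?_)
    · have h : √|ρ μ| * ρ f = 0 := congrFun hf (.inl ρ)
      rw [he]
      exact (mul_eq_zero.1 h).resolve_left (Real.sqrt_ne_zero'.2 (abs_pos.2 (hρ ρ)))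
    · have h1 : (c k * (e f).2 k).re = 0 := congrFun hf (.inr (.inl k))
      have h2 : (c k * (e f).2 k).im = 0 := congrFun hf (.inr (.inr k))
      exact (mul_eq_zero.1 (Complex.ext h1 h2)).resolve_left (hc0 k)
  refine ⟨L.linearEquivOfInjective hL ?_, fun f => ?_⟩
  · rw [← hrank]
    simp [two_mul]
  · have hL' (j) : L.linearEquivOfInjective hL (by rw [← hrank]; simp [two_mul]) f j =
      Sum.elim (fun ρ : F →ₐ[ℝ] ℝ => √|ρ μ| * ρ f)
        (Sum.elim (fun k => (c k * (e f).2 k).re) fun k => (c k * (e f).2 k).im) j := rfl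
    simp_rw [hL']
    rw [← Algebra.trace_eq_of_algEquiv e, Algebra.trace_prod_apply, Algebra.trace_pi_eq_sum,
      Algebra.trace_pi_eq_sum]
    simp only [Fintype.sum_sum_type, Sum.elim_inl, Sum.elim_inr, Algebra.trace_complex_apply,
      Algebra.trace_self_apply, he]
    rw [← Finset.sum_add_distrib]
    congr 1
    · refine Finset.sum_congr rfl fun ρ _ => ?_
      rw [mul_pow, Real.sq_sqrt (abs_nonneg _), ← mul_assoc, map_mul, map_pow]
      congr 1
      rcases (hρ ρ).lt_or_gt with h | h
      · simp [Real.sign_of_neg h, abs_of_neg h]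
      · simp [Real.sign_of_pos h, abs_of_pos h]
    · refine Finset.sum_congr rfl fun k _ => ?_
      have h : 2 * ((e (μ * f ^ 2)).2 k) = (c k * (e f).2 k) ^ 2 := by
        rw [mul_pow, hc]
        simp [mul_assoc]
      have h' := congrArg Complex.re h
      rw [pow_two (c k * _), Complex.mul_re (c k * _), Complex.mul_re 2, Complex.re_ofNat,
        Complex.im_ofNat, zero_mul, sub_zero] at h'
      linarith

/-- Counts how many of the signs of `x` and of `-(x * y)` are `1` and how many are `-1`. -/
theorem Real.ite_sign_add_ite_sign {x y : ℝ} (hx : x ≠ 0) (hy : y ≠ 0) :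
    ((if Real.sign x = 1 then 1 else 0) + (if Real.sign (-(x * y)) = 1 then 1 else 0) : ℤ) =
      1 + (if y < 0 ∧ 0 < x then 1 else 0) - (if y < 0 ∧ x < 0 then 1 else 0) ∧
    ((if Real.sign x = -1 then 1 else 0) + (if Real.sign (-(x * y)) = -1 then 1 else 0) : ℤ) =
      1 + (if y < 0 ∧ x < 0 then 1 else 0) - (if y < 0 ∧ 0 < x then 1 else 0) := by
  rcases hx.lt_or_gt with h | h <;> rcases hy.lt_or_gt with h' | h'
  · rw [Real.sign_of_neg h, Real.sign_of_neg (neg_neg_of_pos (mul_pos_of_neg_of_neg h h'))]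
    norm_num [h, h', h.not_gt, h'.not_gt]
  · rw [Real.sign_of_neg h, Real.sign_of_pos (neg_pos.2 (mul_neg_of_neg_of_pos h h'))]
    norm_num [h, h', h.not_gt, h'.not_gt]
  · rw [Real.sign_of_pos h, Real.sign_of_pos (neg_pos.2 (mul_neg_of_pos_of_neg h h'))]
    norm_num [h, h', h.not_gt, h'.not_gt]
  · rw [Real.sign_of_pos h, Real.sign_of_neg (neg_neg_of_pos (mul_pos h h'))]
    norm_num [h, h', h.not_gt, h'.not_gt]

section Involution

variable {E : Type u} [CommRing E] [Algebra ℝ E] {n : ℕ}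
  {σ : E ≃ₐ[ℝ] E} {F : Subalgebra ℝ E}

/-- An involution of a finite reduced real algebra whose fixed subalgebra has half the dimension
negates some unit. -/
theorem AlgEquiv.exists_isUnit_apply_eq_neg [FiniteDimensional ℝ E] [IsReduced E]
    (hdim : Module.finrank ℝ E = 2 * n) (hσ : ∀ x, σ (σ x) = x) (hF : ∀ x, x ∈ F ↔ σ x = x)
    (hfix : Module.finrank ℝ F = n) : ∃ δ, IsUnit δ ∧ σ δ = -δ := by
  have : IsArtinianRing E := IsArtinianRing.of_finite ℝ E
  let d : E →ₗ[ℝ] E := σ.toLinearMap - LinearMap.id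
  have hker : LinearMap.ker d = F.toSubmodule := by
    ext x
    simp [d, hF, sub_eq_zero]
  have hneg (v : LinearMap.range d) : σ v = -v := by
    obtain ⟨_, x, rfl⟩ := v
    simp [d, hσ]
  have hrange : Module.finrank ℝ (LinearMap.range d) = n := by
    have h := d.finrank_range_add_finrank_ker
    rw [hker, Subalgebra.finrank_toSubmodule, hfix] at h
    omega
  obtain ⟨δ, hδ⟩ : ∃ δ : LinearMap.range d, ∀ m : MaximalSpectrum E, (δ : E) ∈ m.asIdeal →
      ∀ v : LinearMap.range d, (v : E) ∈ m.asIdeal := by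
    by_contra! h
    let p : {m : MaximalSpectrum E // ∃ v : LinearMap.range d, (v : E) ∉ m.asIdeal} →
        Subspace ℝ (LinearMap.range d) :=
      fun m => (m.1.asIdeal.restrictScalars ℝ).comap (LinearMap.range d).subtype
    obtain ⟨⟨m, v, hv⟩, hm⟩ := Subspace.exists_eq_top_of_iUnion_eq_univ (p := p)
      (Set.eq_univ_of_forall fun δ => by
        obtain ⟨m, hδm, v, hv⟩ := h δ
        exact Set.mem_iUnion.2 ⟨⟨m, v, hv⟩, hδm⟩)
    exact hv (show v ∈ p ⟨m, v, hv⟩ by rw [hm]; trivial)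
  let M : LinearMap.range d →ₗ[ℝ] F :=
    ((LinearMap.mulLeft ℝ (δ : E)).comp (LinearMap.range d).subtype).codRestrict F.toSubmodule
      fun v => (hF _).2 (by simp [hneg])
  have hM : Function.Injective M := by
    refine (injective_iff_map_eq_zero M).2 fun v hv => Subtype.ext ?_
    have hv' : (δ : E) * v = 0 := congrArg Subtype.val hv
    refine (IsArtinianRing.equivPi E).injective (funext fun m => ?_)
    rw [ZeroMemClass.coe_zero, map_zero, IsArtinianRing.equivPi_apply]
    refine Ideal.Quotient.eq_zero_iff_mem.2 ?_
    refine (m.isMaximal.isPrime.mem_or_mem (hv' ▸ m.asIdeal.zero_mem)).elim (fun h => hδ m h v) id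
  obtain ⟨v, hv⟩ :=
    (LinearMap.injective_iff_surjective_of_finrank_eq_finrank (hrange.trans hfix.symm)).1 hM 1
  exact ⟨δ, .of_mul_eq_one _ (congrArg Subtype.val hv), hneg δ⟩

/-- If the unit `δ` is negated by the involution, then `1, δ` is a basis of the algebra over the
fixed subalgebra. -/
theorem AlgEquiv.exists_linearEquiv_prod_fixed [FiniteDimensional ℝ E]
    (hdim : Module.finrank ℝ E = 2 * n) (hF : ∀ x, x ∈ F ↔ σ x = x)
    (hfix : Module.finrank ℝ F = n) {δ : E} (hδ : IsUnit δ) (hσδ : σ δ = -δ) :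
    ∃ e : (F × F) ≃ₗ[ℝ] E, ∀ p, e p = p.1 + δ * p.2 := by
  let f : F × F →ₗ[ℝ] E :=
    F.val.toLinearMap.coprod ((LinearMap.mulLeft ℝ δ).comp F.val.toLinearMap)
  have hf (p : F × F) : f p = p.1 + δ * p.2 := by simp [f]
  refine ⟨f.linearEquivOfInjective ?_ (by simp [hfix, hdim, two_mul]), hf⟩
  refine (injective_iff_map_eq_zero f).2 fun ⟨a, b⟩ h => ?_
  rw [hf] at h
  have ha : σ a = a := (hF _).1 a.2
  have hb : σ b = b := (hF _).1 b.2
  have h' := congrArg σ h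
  rw [map_add, map_mul, hσδ, ha, hb, map_zero] at h'
  dsimp only at h h'
  have ha0 : (2 : ℝ) • (a : E) = 0 := by
    rw [two_smul]
    linear_combination h + h'
  have ha1 : (a : E) = 0 := (smul_eq_zero.1 ha0).resolve_left two_ne_zero
  have hb1 : (b : E) = 0 := by
    rw [ha1, zero_add] at h
    exact hδ.mul_right_eq_zero.1 h
  exact Prod.ext (Subtype.ext ha1) (Subtype.ext hb1)

/-- A trace form twisted by an involution is an orthogonal sum of two trace forms of the fixed
subalgebra. -/
theorem AlgEquiv.trace_mul_mul_apply [FiniteDimensional ℝ E]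
    (hF : ∀ x, x ∈ F ↔ σ x = x) {δ : E} (hσδ : σ δ = -δ) (d l : F) (hd : (d : E) = δ ^ 2)
    (e : (F × F) ≃ₗ[ℝ] E) (he : ∀ p, e p = p.1 + δ * p.2) (p : F × F) :
    (1 / 2) * Algebra.trace ℝ E (l * e p * σ (e p)) =
      Algebra.trace ℝ F (l * p.1 ^ 2) + Algebra.trace ℝ F (-(l * d) * p.2 ^ 2) := by
  have htr (a : F) : Algebra.trace ℝ E a = 2 * Algebra.trace ℝ F a := by
    have h : Algebra.lmul ℝ E a = e.conj ((Algebra.lmul ℝ F a).prodMap (Algebra.lmul ℝ F a)) := by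
      ext x
      obtain ⟨q, rfl⟩ := e.surjective x
      rw [LinearEquiv.conj_apply_apply, LinearEquiv.symm_apply_apply, he, he]
      simp
      ring
    rw [Algebra.trace_apply, h, LinearMap.trace_conj', LinearMap.trace_prodMap', two_mul]
    rfl
  have h1 : σ p.1 = p.1 := (hF _).1 p.1.2
  have h2 : σ p.2 = p.2 := (hF _).1 p.2.2
  have h : (l * e p * σ (e p) : E) = ↑(l * p.1 ^ 2 + -(l * d) * p.2 ^ 2) := by
    rw [he, map_add, map_mul, h1, h2, hσδ]
    push_cast
    rw [hd]
    ring
  rw [h, htr, map_add]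
  ring

/-- A real point of a subalgebra extends to the algebra as soon as it takes a
nonnegative value at a square `δ ^ 2` such that `1, δ` is a basis over the subalgebra. -/
theorem Subalgebra.exists_algHom_extension
    (d : F) {δ : E} (hd : (d : E) = δ ^ 2)
    (e : (F × F) ≃ₗ[ℝ] E) (he : ∀ p, e p = p.1 + δ * p.2) (ρ : F →ₐ[ℝ] ℝ) (hρ : 0 ≤ ρ d) :
    ∃ ρ' : E →ₐ[ℝ] ℝ, ∀ y : F, ρ' y = ρ y := by
  let f : E →ₗ[ℝ] ℝ := (ρ.toLinearMap.coprod (√(ρ d) • ρ.toLinearMap)).comp e.symm.toLinearMap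
  have hf (p : F × F) : f (e p) = ρ p.1 + √(ρ d) * ρ p.2 := by simp [f]
  have hfF (y : F) : f y = ρ y := by simpa [he] using hf (y, 0)
  refine ⟨AlgHom.ofLinearMap f (by simpa using hfF 1) fun x y => ?_, hfF⟩
  obtain ⟨p, rfl⟩ := e.surjective x
  obtain ⟨q, rfl⟩ := e.surjective y
  have h : e p * e q = e (p.1 * q.1 + d * (p.2 * q.2), p.1 * q.2 + p.2 * q.1) := by
    simp only [he]
    push_cast
    rw [hd]
    ring
  rw [h, hf, hf, hf]
  simp only [map_add, map_mul]
  linear_combination (-ρ p.2 * ρ q.2) * Real.sq_sqrt hρ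

end Involution

/-- Let `E` be an étale `ℝ`-algebra of dimension `2n` with involution `σ`
whose fixed subalgebra `E^σ` has dimension `n`, and let `λ` be a unit of `E^σ`.  Let `s`
(resp. `r`) be the number of `ℝ`-algebra homomorphisms `ρ : E^σ → ℝ` that are ramified in `E`
(do not extend to `E`) with `ρ(λ) > 0` (resp. `ρ(λ) < 0`).  Then the real quadratic form
`q_{E,λ}(x) = ½·Tr_{E/ℝ}(λ·x·σ(x))` has signature `(n + s − r, n + r − s)`: it is equivalent
to a diagonal form with `n + s − r` coefficients `+1` and `n + r − s` coefficients `−1`. -/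
theorem stmt2 (E : Type) [CommRing E] [Algebra ℝ E]
    [Algebra.Etale ℝ E] [FiniteDimensional ℝ E]
    (n : ℕ) (hn : 1 ≤ n) (hdim : Module.finrank ℝ E = 2 * n)
    (σ : E ≃ₐ[ℝ] E) (hσ : ∀ x, σ (σ x) = x)
    (hfix : Module.finrank ℝ ↥(AlgHom.equalizer σ.toAlgHom (AlgHom.id ℝ E)) = n)
    (lam : E) (hlam : IsUnit lam) (hlamfix : σ lam = lam)
    (s r : ℕ)
    (hs : s = {ρ : ↥(AlgHom.equalizer σ.toAlgHom (AlgHom.id ℝ E)) →ₐ[ℝ] ℝ |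
        (¬ ∃ ρ' : E →ₐ[ℝ] ℝ, ∀ y : ↥(AlgHom.equalizer σ.toAlgHom (AlgHom.id ℝ E)),
          ρ' (y : E) = ρ y) ∧
        0 < ρ ⟨lam, hlamfix⟩}.ncard)
    (hr : r = {ρ : ↥(AlgHom.equalizer σ.toAlgHom (AlgHom.id ℝ E)) →ₐ[ℝ] ℝ |
        (¬ ∃ ρ' : E →ₐ[ℝ] ℝ, ∀ y : ↥(AlgHom.equalizer σ.toAlgHom (AlgHom.id ℝ E)),
          ρ' (y : E) = ρ y) ∧
        ρ ⟨lam, hlamfix⟩ < 0}.ncard)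
    (Q : QuadraticForm ℝ E)
    (hQ : ∀ x : E, Q x = (1 / 2) * Algebra.trace ℝ E (lam * x * σ x)) :
    ∃ w : Fin (2 * n) → ℝ,
      (∀ i, w i = 1 ∨ w i = -1) ∧
      (({i | w i = 1} : Set (Fin (2 * n))).ncard : ℤ) = (n : ℤ) + s - r ∧
      (({i | w i = -1} : Set (Fin (2 * n))).ncard : ℤ) = (n : ℤ) + r - s ∧
      QuadraticMap.Equivalent Q (QuadraticMap.weightedSumSquares ℝ w) := by
  classical
  have hF (x : E) : x ∈ AlgHom.equalizer σ.toAlgHom (AlgHom.id ℝ E) ↔ σ x = x := Iff.rfl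
  obtain ⟨l, hl⟩ : ∃ l : AlgHom.equalizer σ.toAlgHom (AlgHom.id ℝ E), l = ⟨lam, hlamfix⟩ :=
    ⟨_, rfl⟩
  have hl_val : (l : E) = lam := by rw [hl]
  rw [← hl] at hs hr
  clear hl
  generalize AlgHom.equalizer σ.toAlgHom (AlgHom.id ℝ E) = F at *
  have : IsReduced E := Algebra.FormallyUnramified.isReduced_of_field ℝ E
  have : IsReduced F := isReduced_of_injective F.val Subtype.val_injective
  have := (Real.exists_algEquiv_prod F).1
  have := Fintype.ofFinite (F →ₐ[ℝ] ℝ)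
  obtain ⟨δ, hδ, hσδ⟩ := AlgEquiv.exists_isUnit_apply_eq_neg hdim hσ hF hfix
  obtain ⟨e, he⟩ := AlgEquiv.exists_linearEquiv_prod_fixed hdim hF hfix hδ hσδ
  have hunit (x : F) (hx : IsUnit (x : E)) : IsUnit x := by
    obtain ⟨y, hy⟩ := hx.exists_right_inv
    have hy' : y ∈ F := (hF y).2 <| hx.mul_left_cancel <| by
      have h := congrArg σ hy
      rw [map_mul, (hF _).1 x.2, map_one] at h
      rw [h, hy]
    exact .of_mul_eq_one ⟨y, hy'⟩ (Subtype.ext hy)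
  obtain ⟨d, hd⟩ : ∃ d : F, (d : E) = δ ^ 2 := ⟨⟨δ ^ 2, (hF _).2 (by simp [hσδ])⟩, rfl⟩
  have hd_unit : IsUnit d := hunit d (hd ▸ hδ.pow 2)
  have hl_unit : IsUnit l := hunit l (hl_val ▸ hlam)
  have hext (ρ : F →ₐ[ℝ] ℝ) : (¬ ∃ ρ' : E →ₐ[ℝ] ℝ, ∀ y : F, ρ' y = ρ y) ↔ ρ d < 0 := by
    refine ⟨fun h => ?_, fun h ⟨ρ', hρ'⟩ => ?_⟩
    · by_contra! h0
      exact h (Subalgebra.exists_algHom_extension d hd e he ρ h0)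
    · rw [← hρ', hd, map_pow] at h
      exact absurd h (sq_nonneg _).not_gt
  simp_rw [hext] at hs hr
  have hs' : (s : ℤ) = ∑ ρ : F →ₐ[ℝ] ℝ, if ρ d < 0 ∧ 0 < ρ l then 1 else 0 := by
    simp [hs, Set.ncard_eq_toFinset_card']
  have hr' : (r : ℤ) = ∑ ρ : F →ₐ[ℝ] ℝ, if ρ d < 0 ∧ ρ l < 0 then 1 else 0 := by
    simp [hr, Set.ncard_eq_toFinset_card']
  obtain ⟨κ, _, hcard, hdiag⟩ := Real.exists_diagonalization_traceForm F
  obtain ⟨L₁, hL₁⟩ := hdiag l hl_unit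
  obtain ⟨L₂, hL₂⟩ := hdiag (-(l * d)) (hl_unit.mul hd_unit).neg
  let W (μ : F) : (F →ₐ[ℝ] ℝ) ⊕ κ ⊕ κ → ℝ :=
    Sum.elim (fun ρ => Real.sign (ρ μ)) (Sum.elim (fun _ => 1) fun _ => -1)
  let w := Sum.elim (W l) (W (-(l * d)))
  rw [hfix] at hcard
  let ε : Fin (2 * n) ≃ ((F →ₐ[ℝ] ℝ) ⊕ κ ⊕ κ) ⊕ ((F →ₐ[ℝ] ℝ) ⊕ κ ⊕ κ) :=
    (Fintype.equivFinOfCardEq (by simp; omega)).symm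
  have hncard (c : ℝ) : (({i | w (ε i) = c} : Set (Fin (2 * n))).ncard : ℤ) =
      ∑ j, if w j = c then 1 else 0 := by
    rw [← ε.sum_comp]
    simp [Set.ncard_eq_toFinset_card']
  have hlρ (ρ : F →ₐ[ℝ] ℝ) : ρ l ≠ 0 := (hl_unit.map ρ).ne_zero
  have hdρ (ρ : F →ₐ[ℝ] ℝ) : ρ d ≠ 0 := (hd_unit.map ρ).ne_zero
  have hcard' : (∑ ρ : F →ₐ[ℝ] ℝ, 1 : ℤ) + 2 * Fintype.card κ = n := by
    rw [← hcard]
    simp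
  have hsum (c : ℝ) : (∑ j, if w j = c then 1 else 0 : ℤ) =
      ∑ ρ : F →ₐ[ℝ] ℝ, ((if Real.sign (ρ l) = c then 1 else 0) +
        (if Real.sign (-(ρ l * ρ d)) = c then 1 else 0)) +
      2 * (Fintype.card κ * ((if 1 = c then 1 else 0) + (if -1 = c then 1 else 0))) := by
    have h₁ (ρ) : w (.inl (.inl ρ)) = Real.sign (ρ l) := rfl
    have h₂ (k) : w (.inl (.inr (.inl k))) = 1 := rfl
    have h₃ (k) : w (.inl (.inr (.inr k))) = -1 := rfl
    have h₄ (ρ) : w (.inr (.inl ρ)) = Real.sign (-(ρ l * ρ d)) := by simp [w, W]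
    have h₅ (k) : w (.inr (.inr (.inl k))) = 1 := rfl
    have h₆ (k) : w (.inr (.inr (.inr k))) = -1 := rfl
    simp only [Fintype.sum_sum_type, h₁, h₂, h₃, h₄, h₅, h₆, Finset.sum_add_distrib,
      Finset.sum_const, Finset.card_univ, nsmul_eq_mul]
    ring
  refine ⟨w ∘ ε, fun i => ?_, ?_, ?_, ?_⟩
  · have hW (μ : F) (hμ : IsUnit μ) (j) : W μ j = 1 ∨ W μ j = -1 := by
      rcases j with ρ | k | k
      · rcases (hμ.map ρ).ne_zero.lt_or_gt with h | h
        · exact .inr (Real.sign_of_neg h)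
        · exact .inl (Real.sign_of_pos h)
      · exact .inl rfl
      · exact .inr rfl
    rcases h : ε i with j | j
    · rw [Function.comp_apply, h]
      exact hW _ hl_unit j
    · rw [Function.comp_apply, h]
      exact hW _ (hl_unit.mul hd_unit).neg j
  · refine (hncard 1).trans ?_
    rw [hsum, hs', hr', ← hcard',
      Finset.sum_congr rfl fun ρ _ => (Real.ite_sign_add_ite_sign (hlρ ρ) (hdρ ρ)).1,
      Finset.sum_sub_distrib, Finset.sum_add_distrib, if_pos rfl, if_neg (by norm_num)]
    ring
  · refine (hncard (-1)).trans ?_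
    rw [hsum, hs', hr', ← hcard',
      Finset.sum_congr rfl fun ρ _ => (Real.ite_sign_add_ite_sign (hlρ ρ) (hdρ ρ)).2,
      Finset.sum_sub_distrib, Finset.sum_add_distrib, if_neg (by norm_num), if_pos rfl]
    ring
  · let T : E ≃ₗ[ℝ] (Fin (2 * n) → ℝ) := e.symm ≪≫ₗ (L₁.prodCongr L₂) ≪≫ₗ
      (LinearEquiv.sumArrowLequivProdArrow _ _ ℝ ℝ).symm ≪≫ₗ (LinearEquiv.funCongrLeft ℝ ℝ ε)
    refine ⟨⟨T, fun x => ?_⟩⟩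
    obtain ⟨p, rfl⟩ := e.surjective x
    have hT (i) : T (e p) i = Sum.elim (L₁ p.1) (L₂ p.2) (ε i) := by
      change Sum.elim (L₁ (e.symm (e p)).1) (L₂ (e.symm (e p)).2) (ε i) = _
      rw [e.symm_apply_apply]
    refine (QuadraticMap.weightedSumSquares_apply _ _).trans ?_
    change ∑ i, (w ∘ ε) i • (T (e p) i * T (e p) i) = Q (e p)
    rw [hQ, ← hl_val, AlgEquiv.trace_mul_mul_apply hF hσδ d l hd e he, hL₁, hL₂]
    simp only [hT, Function.comp_apply]
    rw [ε.sum_comp fun j => w j • (Sum.elim (L₁ p.1) (L₂ p.2) j * Sum.elim (L₁ p.1) (L₂ p.2) j)]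
    simp [w, W, Fintype.sum_sum_type, pow_two]
end

section
/- Let ρ : (E,σ) ↪ (A,τ) be an embedding such that the centralizer of ρ(E) in A equals ρ(E). Then for ε ∈ A^×, the map τ_ε = Int_ε ∘ τ satisfies τ_ε(ρ(e)) = ρ(σ(e)) for all e ∈ E if and only if ε ∈ ρ(E). Moreover, for every δ ∈ E^× with σ(δ) = −δ, the map τ_{ρ(δ)} is again an involution of A and ρ is an embedding of (E,σ) into (A, τ_{ρ(δ)}). -/
universe u

/-- Let `ρ : (E,σ) ↪ (A,τ)` be an embedding of an étale algebra with
involution into an algebra with involution such that the centralizer of `ρ(E)` in `A` equals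
`ρ(E)`.  Then for `ε ∈ A^×`, the map `τ_ε = Int_ε ∘ τ` satisfies `τ_ε(ρ(e)) = ρ(σ(e))` for
all `e ∈ E` if and only if `ε ∈ ρ(E)`.  Moreover, for every `δ ∈ E^×` with `σ(δ) = −δ`, the
map `τ_{ρ(δ)}` is again an involution of `A` and `ρ` is an embedding of `(E,σ)` into
`(A, τ_{ρ(δ)})`. -/
theorem stmt6 (k E A : Type u) [Field k] (hchar : (2 : k) ≠ 0)
    [CommRing E] [Algebra k E] [Algebra.Etale k E]
    [Ring A] [Algebra k A] [FiniteDimensional k A]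
    (τ : A →ₗ[k] A) (hτmul : ∀ x y : A, τ (x * y) = τ y * τ x) (hτ2 : ∀ x : A, τ (τ x) = x)
    (σ : E ≃ₐ[k] E) (hσ : ∀ x, σ (σ x) = x)
    (ρ : E →ₐ[k] A) (hρinj : Function.Injective ρ)
    (hcompat : ∀ e : E, τ (ρ e) = ρ (σ e))
    (hcent : {a : A | ∀ e : E, a * ρ e = ρ e * a} = Set.range ⇑ρ) :
    (∀ ε : Aˣ,
      (∀ e : E, (ε : A) * τ (ρ e) * ((ε⁻¹ : Aˣ) : A) = ρ (σ e)) ↔ (ε : A) ∈ Set.range ⇑ρ) ∧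
    (∀ δ : E, IsUnit δ → σ δ = -δ →
      (∀ x y : A, ρ δ * τ (x * y) * Ring.inverse (ρ δ)
          = (ρ δ * τ y * Ring.inverse (ρ δ)) * (ρ δ * τ x * Ring.inverse (ρ δ))) ∧
      (∀ x : A, ρ δ * τ (ρ δ * τ x * Ring.inverse (ρ δ)) * Ring.inverse (ρ δ) = x) ∧
      (∀ e : E, ρ δ * τ (ρ e) * Ring.inverse (ρ δ) = ρ (σ e))) := by
  have conj_iff : ∀ ε : Aˣ,
      (∀ e : E, (ε : A) * τ (ρ e) * ((ε⁻¹ : Aˣ) : A) = ρ (σ e)) ↔ (ε : A) ∈ Set.range ⇑ρ := by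
    intro ε
    simp only [← hcent, Set.mem_ofPred_eq, hcompat, Units.mul_inv_eq_iff_eq_mul]
    exact (σ.surjective.forall (p := fun e => (ε : A) * ρ e = ρ e * ε)).symm
  refine ⟨conj_iff, ?_⟩
  rintro _ ⟨d, rfl⟩ hd
  obtain ⟨u, hu⟩ : ∃ u : Aˣ, (u : A) = ρ d := ⟨Units.map (ρ : E →* A) d, rfl⟩
  have τ_one : τ 1 = 1 := by simpa using hcompat 1
  have τ_u : τ u = -u := by rw [hu, hcompat, hd, map_neg]
  have τ_inv : τ (↑u⁻¹ : A) = -(↑u⁻¹ : A) := by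
    have h := hτmul (↑u⁻¹ : A) u
    rw [Units.inv_mul, τ_one, τ_u, neg_mul, ← mul_neg] at h
    exact neg_eq_iff_eq_neg.mp (Units.inv_eq_of_mul_eq_one_right h.symm).symm
  simp only [← hu, Ring.inverse_unit]
  refine ⟨fun x y => ?_, fun x => ?_, (conj_iff u).2 ⟨d, hu.symm⟩⟩
  · simp [hτmul, mul_assoc]
  · simp [hτmul, hτ2, τ_u, τ_inv, mul_assoc]
end

section
/- Suppose A is central simple over k with dim_k A = (2n)², E has dimension 2n over k, and dim_k E^σ = n. If ρ : (E,σ) ↪ (A,τ) and ρ' : (E,σ) ↪ (A,τ) are two embeddings (with respect to the same involution τ of A), then there exists a unit g ∈ A^× such that ρ'(x) = g·ρ(x)·g^{-1} for all x ∈ E. -/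
universe u

open Module TensorProduct

section CentralSimple

variable {k : Type*} [Field k] {A : Type*} [Ring A] [Algebra k A]

theorem AlgHom.mulLeftRight_surjective_of_isSimpleRing [FiniteDimensional k A] [IsSimpleRing A]
    [Algebra.IsCentral k A] : Function.Surjective (AlgHom.mulLeftRight k A) := by
  let _ : Module (A ⊗[k] Aᵐᵒᵖ) A := TensorProduct.Algebra.module
  have smul_apply (r : A ⊗[k] Aᵐᵒᵖ) (a : A) : r • a = AlgHom.mulLeftRight k A r a := rfl
  have : IsSimpleModule (A ⊗[k] Aᵐᵒᵖ) A := by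
    refine isSimpleModule_iff_toSpanSingleton_surjective.mpr ⟨inferInstance, fun m hm a => ?_⟩
    let I : TwoSidedIdeal A := TwoSidedIdeal.mk' (Submodule.span (A ⊗[k] Aᵐᵒᵖ) {m} : Set A)
      (zero_mem _) add_mem neg_mem
      (fun {x y} hy => by
        simpa [smul_apply] using Submodule.smul_mem _ (x ⊗ₜ[k] (1 : Aᵐᵒᵖ)) hy)
      (fun {x y} hx => by
        simpa [smul_apply] using Submodule.smul_mem _ ((1 : A) ⊗ₜ[k] MulOpposite.op y) hx)
    have hI : I = ⊤ := (eq_bot_or_eq_top I).resolve_left fun h => hm <| by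
      have : m ∈ I := (TwoSidedIdeal.mem_mk' ..).mpr (Submodule.mem_span_singleton_self m)
      rwa [h, TwoSidedIdeal.mem_bot] at this
    have ha : a ∈ I := hI ▸ TwoSidedIdeal.mem_top A
    exact Submodule.mem_span_singleton.mp ((TwoSidedIdeal.mem_mk' ..).mp ha)
  intro f
  have commutes (φ : Module.End (A ⊗[k] Aᵐᵒᵖ) A) : ∃ c : k, ∀ a, φ a = c • a := by
    have left (a b : A) : φ (a * b) = a * φ b := by
      simpa [smul_apply] using φ.map_smul (a ⊗ₜ[k] (1 : Aᵐᵒᵖ)) b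
    have right (a b : A) : φ (a * b) = φ a * b := by
      simpa [smul_apply] using φ.map_smul ((1 : A) ⊗ₜ[k] MulOpposite.op b) a
    have hc : φ 1 ∈ Subalgebra.center k A :=
      Subalgebra.mem_center_iff.mpr fun b => by rw [← left, ← right, mul_one, one_mul]
    rw [Algebra.IsCentral.center_eq_bot, Algebra.mem_bot] at hc
    obtain ⟨c, hc⟩ := hc
    exact ⟨c, fun a => by rw [Algebra.smul_def, hc, ← right, one_mul]⟩
  let F : Module.End (Module.End (A ⊗[k] Aᵐᵒᵖ) A) A :=
    { toFun := f
      map_add' := f.map_add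
      map_smul' := fun φ a => by
        obtain ⟨c, hc⟩ := commutes φ
        simp [hc] }
  let b := finBasis k A
  classical
  obtain ⟨r, hr⟩ := jacobson_density F (Finset.univ.image b)
  exact ⟨r, b.ext fun i => (hr (b i) (Finset.mem_image_of_mem _ (Finset.mem_univ i))).symm⟩

theorem TwoSidedIdeal.lTensor_mem [FiniteDimensional k A] [IsSimpleRing A] [Algebra.IsCentral k A]
    {K : Type*} [Ring K] [Algebra k K] (I : TwoSidedIdeal (K ⊗[k] A)) (f : A →ₗ[k] A)
    {x : K ⊗[k] A} (hx : x ∈ I) : f.lTensor K x ∈ I := by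
  obtain ⟨r, rfl⟩ := AlgHom.mulLeftRight_surjective_of_isSimpleRing (k := k) f
  induction r with
  | zero => simp
  | add r s hr hs => simpa [LinearMap.lTensor_add] using I.add_mem hr hs
  | tmul a b =>
    have : (AlgHom.mulLeftRight k A (a ⊗ₜ b)).lTensor K x =
        ((1 : K) ⊗ₜ[k] a) * x * ((1 : K) ⊗ₜ[k] b.unop) := by
      clear hx
      induction x with
      | zero => simp
      | add x y hx hy => rw [map_add, hx, hy, mul_add, add_mul]
      | tmul c d => simp
    rw [this]
    exact I.mul_mem_right _ _ (I.mul_mem_left _ _ hx)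

variable (k A) in
theorem IsSimpleRing.tensorProduct_of_isCentral [FiniteDimensional k A] [IsSimpleRing A]
    [Algebra.IsCentral k A] (K : Type*) [Field K] [Algebra k K] : IsSimpleRing (K ⊗[k] A) := by
  refine ⟨⟨fun I => or_iff_not_imp_left.mpr fun hI => ?_⟩⟩
  obtain ⟨x, hx, hx0⟩ : ∃ x ∈ I, x ≠ 0 := by
    by_contra! h
    exact hI (le_bot_iff.mp fun x hx => (TwoSidedIdeal.mem_bot _).mpr (h x hx))
  let b := finBasis k A
  let B := Algebra.TensorProduct.basis K b
  obtain ⟨i, hi⟩ : ∃ i, B.repr x i ≠ 0 := by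
    by_contra! h
    exact hx0 (B.repr.map_eq_zero_iff.mp (Finsupp.ext h))
  have key : ((b.coord i).smulRight (1 : A)).lTensor K x = B.repr x i ⊗ₜ[k] (1 : A) := by
    clear hx hx0 hi
    induction x with
    | zero => simp
    | add x y hx hy => rw [map_add, hx, hy, map_add, Finsupp.add_apply, add_tmul]
    | tmul c d =>
      simp [B, mul_comm c, ← Algebra.smul_def, TensorProduct.smul_tmul,
        ← Algebra.algebraMap_eq_smul_one]
  have h1 : (1 : K ⊗[k] A) ∈ I := by
    have := I.mul_mem_left ((B.repr x i)⁻¹ ⊗ₜ[k] (1 : A)) _ (key ▸ I.lTensor_mem _ hx)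
    simpa [hi, Algebra.TensorProduct.one_def] using this
  exact I.one_mem_iff.mp h1

end CentralSimple

section SimpleArtinian

variable {k : Type*} [Field k] {B : Type*} [Ring B] [IsSimpleRing B] [IsArtinianRing B]

theorem IsSimpleRing.isIsotypicOfType (S : Submodule B B) [IsSimpleModule B S]
    (M : Type*) [AddCommGroup M] [Module B M] : IsIsotypicOfType B M S := fun m _ => by
  obtain ⟨I, ⟨e⟩⟩ := IsSemisimpleRing.exists_linearEquiv_ideal_of_isSimpleModule B m
  have : IsSimpleModule B I := .congr e.symm
  obtain ⟨e'⟩ := IsSimpleRing.isIsotypic B B S I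
  exact ⟨e.trans e'⟩

variable [Algebra k B] [FiniteDimensional k B]
  {M N : Type*} [AddCommGroup M] [Module k M] [Module B M] [IsScalarTower k B M]
  [FiniteDimensional k M]
  [AddCommGroup N] [Module k N] [Module B N] [IsScalarTower k B N] [FiniteDimensional k N]

theorem IsSimpleRing.exists_linearEquiv_of_finrank_eq (h : finrank k M = finrank k N) :
    Nonempty (M ≃ₗ[B] N) := by
  obtain ⟨r, _, S, _, -⟩ := (IsSimpleRing.isIsotypic B B).linearEquiv_fun
  have := Module.Finite.of_restrictScalars_finite k B M
  have := Module.Finite.of_restrictScalars_finite k B N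
  obtain ⟨m, ⟨e⟩⟩ := (isIsotypicOfType S M).linearEquiv_fun
  obtain ⟨n, ⟨f⟩⟩ := (isIsotypicOfType S N).linearEquiv_fun
  have hS : 0 < finrank k S := by
    have := IsSimpleModule.nontrivial B S
    have : FiniteDimensional k S := .of_injective (S.subtype.restrictScalars k) S.subtype_injective
    exact finrank_pos
  have hm := (e.restrictScalars k).finrank_eq
  have hn := (f.restrictScalars k).finrank_eq
  rw [finrank_pi_fintype, Finset.sum_const, Finset.card_fin, smul_eq_mul] at hm hn
  obtain rfl : m = n := Nat.eq_of_mul_eq_mul_right hS (by rw [← hm, ← hn, h])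
  exact ⟨e.trans f.symm⟩

theorem IsSimpleRing.finrank_mul_finrank_le_sq [Nontrivial M] {K : Type*} [Field K] [Algebra k K]
    (f : K →ₐ[k] B) (hf : ∀ c b, f c * b = b * f c) :
    finrank k B * finrank k K ≤ finrank k M ^ 2 := by
  obtain ⟨r, _, S, _, ⟨e⟩⟩ := (IsSimpleRing.isIsotypic B B).linearEquiv_fun
  have := Module.Finite.of_restrictScalars_finite k B M
  obtain ⟨m, ⟨g⟩⟩ := (isIsotypicOfType S M).linearEquiv_fun
  have := IsSimpleModule.nontrivial B S
  have : FiniteDimensional k S := .of_injective (S.subtype.restrictScalars k) S.subtype_injective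
  have hB := (e.restrictScalars k).finrank_eq
  have hM := (g.restrictScalars k).finrank_eq
  have hS := ((LinearMap.ringLmapEquivSelf B k S).symm.trans <|
    (LinearEquiv.congrLeft S k e).trans (LinearMap.lsum B (fun _ : Fin r => S) k).symm).finrank_eq
  have : FiniteDimensional k (S →ₗ[B] S) :=
    .of_injective (LinearMap.restrictScalarsₗ k B S S k) (LinearMap.restrictScalars_injective k)
  rw [finrank_pi_fintype, Finset.sum_const, Finset.card_fin, smul_eq_mul] at hB hM hS
  let φ : K →+* Module.End B S :=
    { toFun := fun c =>
        { toFun := fun s => f c • s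
          map_add' := smul_add _
          map_smul' := fun b s => by simp [smul_smul, hf] }
      map_one' := by ext; simp
      map_zero' := by ext; simp
      map_add' := fun _ _ => by ext; simp [add_mul]
      map_mul' := fun c d => by
        ext s
        change f (c * d) * (s : B) = f c * (f d * (s : B))
        rw [map_mul, mul_assoc] }
  let φₗ : K →ₗ[k] (S →ₗ[B] S) := { φ with map_smul' := fun _ _ => by ext; simp [φ] }
  have hK : finrank k K ≤ finrank k (S →ₗ[B] S) :=
    φₗ.finrank_le_finrank_of_injective φ.injective
  have hm : 1 ≤ m := by
    by_contra! h
    obtain rfl : m = 0 := by omega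
    exact not_subsingleton M g.toEquiv.subsingleton
  calc finrank k B * finrank k K ≤ r * finrank k S * finrank k (S →ₗ[B] S) := by rw [hB]; gcongr
    _ = finrank k S * (r * finrank k (S →ₗ[B] S)) := by ring
    _ = finrank k S ^ 2 := by rw [← hS, sq]
    _ ≤ finrank k M ^ 2 := by
      rw [hM]; gcongr; exact Nat.le_mul_of_pos_left _ hm

end SimpleArtinian

section Corner

variable {k : Type*} [Field k] {K : Type*} [Field K] [Algebra k K]
  {A : Type*} [Ring A] [Algebra k A]

/-- The right ideal `f 1 * A` attached to a non-unital algebra homomorphism `f : K → A`,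
on which `K` acts unitally by left multiplication through `f`. -/
def NonUnitalAlgHom.corner (f : K →ₙₐ[k] A) : Submodule Aᵐᵒᵖ A where
  carrier := {v | f 1 * v = v}
  add_mem' hv hw := by simp_all [mul_add]
  zero_mem' := by simp
  smul_mem' a v hv := by simp_all [← mul_assoc]

namespace NonUnitalAlgHom

variable (f f' : K →ₙₐ[k] A)

theorem mem_corner {v : A} : v ∈ f.corner ↔ f 1 * v = v := Iff.rfl

theorem apply_mul_mem_corner (c : K) (v : A) : f c * v ∈ f.corner := by
  rw [mem_corner, ← mul_assoc, ← map_mul, one_mul]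

theorem apply_mem_corner (c : K) : f c ∈ f.corner := by
  rw [mem_corner, ← map_mul, one_mul]

instance : Module K f.corner where
  smul c v := ⟨f c * v, f.apply_mul_mem_corner c v⟩
  one_smul v := Subtype.ext v.2
  mul_smul c d v := Subtype.ext <| by
    change f (c * d) * (v : A) = f c * (f d * v)
    rw [map_mul, mul_assoc]
  smul_zero c := Subtype.ext (mul_zero _)
  smul_add c v w := Subtype.ext (mul_add _ _ _)
  add_smul c d v := Subtype.ext <| by
    change f (c + d) * (v : A) = f c * v + f d * v
    rw [map_add, add_mul]
  zero_smul v := Subtype.ext <| by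
    change f 0 * (v : A) = 0
    rw [map_zero, zero_mul]

theorem coe_smul_corner (c : K) (v : f.corner) : ((c • v : f.corner) : A) = f c * v := rfl

instance : IsScalarTower k K f.corner where
  smul_assoc a c v := Subtype.ext <| by
    change f (a • c) * (v : A) = a • (f c * (v : A))
    rw [map_smul, smul_mul_assoc]

instance : SMulCommClass K Aᵐᵒᵖ f.corner where
  smul_comm c a v := Subtype.ext <| by
    change f c * ((v : A) * a.unop) = f c * (v : A) * a.unop
    rw [mul_assoc]

noncomputable instance : Module (K ⊗[k] Aᵐᵒᵖ) f.corner := TensorProduct.Algebra.module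

theorem tmul_smul_corner (c : K) (a : Aᵐᵒᵖ) (v : f.corner) :
    (c ⊗ₜ[k] a) • v = c • a • v := rfl

instance : IsScalarTower k (K ⊗[k] Aᵐᵒᵖ) f.corner where
  smul_assoc a x v := by
    change TensorProduct.Algebra.moduleAux (a • x) v = a • TensorProduct.Algebra.moduleAux x v
    rw [map_smul, LinearMap.smul_apply]

variable [FiniteDimensional k A]

instance : FiniteDimensional k f.corner :=
  .of_injective (f.corner.subtype.restrictScalars k) f.corner.subtype_injective

variable [FiniteDimensional k K] [IsSimpleRing A] [Algebra.IsCentral k A]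

theorem mul_finrank_le_finrank_corner {N : ℕ} (hN : finrank k A = N ^ 2) (hf : f 1 ≠ 0) :
    N * finrank k K ≤ finrank k f.corner := by
  have := IsSimpleRing.tensorProduct_of_isCentral k Aᵐᵒᵖ K
  have := IsArtinianRing.of_finite k (K ⊗[k] Aᵐᵒᵖ)
  have : Nontrivial f.corner := ⟨⟨f 1, f.apply_mem_corner 1⟩, 0, fun h => hf (congrArg (·.1) h)⟩
  have key := IsSimpleRing.finrank_mul_finrank_le_sq (k := k) (B := K ⊗[k] Aᵐᵒᵖ) (M := f.corner)
    (Algebra.TensorProduct.includeLeft : K →ₐ[k] K ⊗[k] Aᵐᵒᵖ) fun c b => by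
      induction b with
      | zero => simp
      | add x y hx hy => rw [mul_add, add_mul, hx, hy]
      | tmul d a => simp [mul_comm]
  rw [finrank_tensorProduct, (MulOpposite.opLinearEquiv k : A ≃ₗ[k] Aᵐᵒᵖ).finrank_eq.symm, hN]
    at key
  refine (Nat.pow_le_pow_iff_left two_ne_zero).mp (le_trans (le_of_eq ?_) key)
  ring

theorem exists_intertwining_of_finrank_corner_eq
    (h : finrank k f.corner = finrank k f'.corner) :
    ∃ u w : A, (∀ c, u * f c = f' c * u) ∧ f' 1 * u = u ∧ f 1 * w = w ∧
      w * u = f 1 ∧ u * w = f' 1 := by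
  have := IsSimpleRing.tensorProduct_of_isCentral k Aᵐᵒᵖ K
  have := IsArtinianRing.of_finite k (K ⊗[k] Aᵐᵒᵖ)
  obtain ⟨φ⟩ := IsSimpleRing.exists_linearEquiv_of_finrank_eq (k := k) (B := K ⊗[k] Aᵐᵒᵖ) h
  have left {p q : K →ₙₐ[k] A} (ψ : p.corner ≃ₗ[K ⊗[k] Aᵐᵒᵖ] q.corner) (c : K) (v : p.corner) :
      ψ (c • v) = c • ψ v := by
    simpa [tmul_smul_corner] using ψ.map_smul (c ⊗ₜ[k] (1 : Aᵐᵒᵖ)) v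
  have right {p q : K →ₙₐ[k] A} (ψ : p.corner ≃ₗ[K ⊗[k] Aᵐᵒᵖ] q.corner) (v : p.corner) :
      (ψ v : A) = ψ ⟨p 1, p.apply_mem_corner 1⟩ * (v : A) := by
    have := ψ.map_smul ((1 : K) ⊗ₜ[k] MulOpposite.op (v : A)) ⟨p 1, p.apply_mem_corner 1⟩
    rw [tmul_smul_corner, tmul_smul_corner, one_smul, one_smul] at this
    rw [← op_smul_eq_mul, ← Submodule.coe_smul, ← this]
    congr 2
    exact Subtype.ext v.2.symm
  refine ⟨φ ⟨f 1, f.apply_mem_corner 1⟩, φ.symm ⟨f' 1, f'.apply_mem_corner 1⟩, fun c => ?_,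
    (φ _).2, (φ.symm _).2, ?_, ?_⟩
  · rw [← coe_smul_corner, ← left, ← right φ ⟨f c, f.apply_mem_corner c⟩]
    congr 2
    exact Subtype.ext (by rw [coe_smul_corner, ← map_mul, mul_one])
  · rw [← right, φ.symm_apply_apply]
  · rw [← right, φ.apply_symm_apply]

end NonUnitalAlgHom

end Corner

section SkolemNoether

variable {k : Type*} [Field k] {A : Type*} [Ring A] [Algebra k A]
  {ι : Type*} [DecidableEq ι] {K : ι → Type*} [∀ i, Field (K i)]
  [∀ i, Algebra k (K i)]

/-- The restriction of an algebra homomorphism to a factor of a product algebra. -/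
def AlgHom.piRestrict (ρ : (Π i, K i) →ₐ[k] A) (i : ι) : K i →ₙₐ[k] A where
  toFun c := ρ (Pi.single i c)
  map_smul' a c := by simp [Pi.single_smul]
  map_zero' := by simp
  map_add' c d := by simp [Pi.single_add]
  map_mul' c d := by rw [Pi.single_mul, map_mul]

namespace AlgHom

variable (ρ ρ' : (Π i, K i) →ₐ[k] A)

theorem piRestrict_apply (i : ι) (c : K i) : ρ.piRestrict i c = ρ (Pi.single i c) := rfl

theorem piRestrict_mul_of_ne {i j : ι} (h : i ≠ j) (c : K i) (d : K j) :
    ρ.piRestrict i c * ρ.piRestrict j d = 0 := by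
  rw [piRestrict_apply, piRestrict_apply, ← map_mul]
  convert map_zero ρ
  ext l
  by_cases hl : l = i
  · subst hl; simp [h]
  · simp [hl]

variable [Fintype ι]

theorem sum_piRestrict (x : Π i, K i) : ∑ i, ρ.piRestrict i (x i) = ρ x := by
  simp_rw [piRestrict_apply, ← map_sum, Finset.univ_sum_single]

variable [FiniteDimensional k A]

theorem sum_finrank_corner_le : ∑ i, finrank k (ρ.piRestrict i).corner ≤ finrank k A := by
  rw [← finrank_pi_fintype k]
  let s : (Π i, (ρ.piRestrict i).corner) →ₗ[k] A :=
    ∑ i, ((ρ.piRestrict i).corner.subtype.restrictScalars k) ∘ₗ LinearMap.proj i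
  refine s.finrank_le_finrank_of_injective ((injective_iff_map_eq_zero s).mpr fun v hv => ?_)
  ext j
  have h : ∀ i, ρ.piRestrict j 1 * (v i : A) = if i = j then (v i : A) else 0 := fun i => by
    split_ifs with hij
    · subst hij; exact (v i).2
    · rw [← (NonUnitalAlgHom.mem_corner _).mp (v i).2, ← mul_assoc,
        piRestrict_mul_of_ne _ (Ne.symm hij), zero_mul]
  have := congrArg (ρ.piRestrict j 1 * ·) hv
  simpa [s, Finset.mul_sum, h] using this

variable [IsSimpleRing A] [Algebra.IsCentral k A] [∀ i, FiniteDimensional k (K i)]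

variable {ρ ρ'} in
theorem finrank_corner_piRestrict (hρ : Function.Injective ρ)
    (hA : finrank k A = finrank k (Π i, K i) ^ 2) (i : ι) :
    finrank k (ρ.piRestrict i).corner = finrank k (Π i, K i) * finrank k (K i) := by
  have hle : ∀ i ∈ Finset.univ, finrank k (Π i, K i) * finrank k (K i) ≤
      finrank k (ρ.piRestrict i).corner := fun i _ =>
    (ρ.piRestrict i).mul_finrank_le_finrank_corner hA fun h0 => by
      have := hρ (h0.trans (map_zero ρ).symm)
      simpa using congrFun this i
  have hsum : ∑ i, finrank k (Π i, K i) * finrank k (K i) = finrank k A := by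
    rw [← Finset.mul_sum, ← finrank_pi_fintype k, hA, sq]
  exact ((Finset.sum_eq_sum_iff_of_le hle).mp
    ((Finset.sum_le_sum hle).antisymm (hsum ▸ ρ.sum_finrank_corner_le)) i (Finset.mem_univ i)).symm

variable {ρ ρ'} in
/-- Two embeddings of a product of fields as a subalgebra of maximal dimension in a central simple
algebra are conjugate. -/
theorem exists_unit_conj_of_pi (hρ : Function.Injective ρ) (hρ' : Function.Injective ρ')
    (hA : finrank k A = finrank k (Π i, K i) ^ 2) :
    ∃ g : Aˣ, ∀ x, ρ' x = g * ρ x * (g⁻¹ : Aˣ) := by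
  choose u w hcomm hu hw hwu huw using fun i =>
    (ρ.piRestrict i).exists_intertwining_of_finrank_corner_eq (ρ'.piRestrict i)
      ((finrank_corner_piRestrict hρ hA i).trans (finrank_corner_piRestrict hρ' hA i).symm)
  have hu' (i) : u i * ρ.piRestrict i 1 = u i := by rw [hcomm, hu]
  have hw' (i) : w i * ρ'.piRestrict i 1 = w i := by rw [← huw, ← mul_assoc, hwu, hw]
  have one (ρ : (Π i, K i) →ₐ[k] A) : ∑ i, ρ.piRestrict i 1 = 1 := by
    simpa using ρ.sum_piRestrict 1
  have hgh : (∑ i, u i) * ∑ i, w i = 1 := by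
    rw [Finset.sum_mul_sum, ← one ρ']
    refine Finset.sum_congr rfl fun i _ => ?_
    rw [Finset.sum_eq_single i _ (by simp), huw]
    intro j _ hj
    rw [← hu', ← hw, mul_assoc, ← mul_assoc (ρ.piRestrict i 1), piRestrict_mul_of_ne _ hj.symm,
      zero_mul, mul_zero]
  have hhg : (∑ i, w i) * ∑ i, u i = 1 := by
    rw [Finset.sum_mul_sum, ← one ρ]
    refine Finset.sum_congr rfl fun i _ => ?_
    rw [Finset.sum_eq_single i _ (by simp), hwu]
    intro j _ hj
    rw [← hw', ← hu, mul_assoc, ← mul_assoc (ρ'.piRestrict i 1), piRestrict_mul_of_ne _ hj.symm,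
      zero_mul, mul_zero]
  refine ⟨⟨∑ i, u i, ∑ i, w i, hgh, hhg⟩, fun x => ?_⟩
  rw [Units.eq_mul_inv_iff_mul_eq]
  change ρ' x * ∑ i, u i = (∑ i, u i) * ρ x
  rw [← sum_piRestrict ρ, ← sum_piRestrict ρ', Finset.sum_mul_sum, Finset.sum_mul_sum]
  refine Finset.sum_congr rfl fun i _ => ?_
  rw [Finset.sum_eq_single i _ (by simp), Finset.sum_eq_single i _ (by simp), hcomm]
  · intro j _ hj
    rw [← hu' i, mul_assoc, piRestrict_mul_of_ne _ hj.symm, mul_zero]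
  · intro j _ hj
    rw [← hu j, ← mul_assoc, piRestrict_mul_of_ne _ hj.symm, zero_mul]

end AlgHom

end SkolemNoether

/-- Suppose `A` is central simple over `k` with `dim_k A = (2n)²`, `E` is an
étale `k`-algebra of dimension `2n` with involution `σ` whose fixed algebra has dimension
`n`, and `τ` is an involution of `A`.  If `ρ, ρ' : (E,σ) ↪ (A,τ)` are two embeddings with
respect to the same involution `τ`, then there is a unit `g ∈ A^×` with
`ρ'(x) = g·ρ(x)·g⁻¹` for all `x ∈ E`. -/
theorem stmt7 (k E A : Type u) [Field k] (hchar : (2 : k) ≠ 0)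
    [CommRing E] [Algebra k E] [Algebra.Etale k E] [FiniteDimensional k E]
    [Ring A] [Algebra k A] [FiniteDimensional k A]
    (n : ℕ) (hn : 1 ≤ n)
    (hdimA : Module.finrank k A = (2 * n) ^ 2)
    (hcentral : ∀ a : A, (∀ b : A, a * b = b * a) → ∃ c : k, a = algebraMap k A c)
    (hsimple : ∀ I : TwoSidedIdeal A, I = ⊥ ∨ I = ⊤)
    (τ : A →ₗ[k] A) (hτmul : ∀ x y : A, τ (x * y) = τ y * τ x) (hτ2 : ∀ x : A, τ (τ x) = x)
    (σ : E ≃ₐ[k] E) (hσ : ∀ x, σ (σ x) = x)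
    (hdimE : Module.finrank k E = 2 * n)
    (hfix : Module.finrank k ↥(AlgHom.equalizer σ.toAlgHom (AlgHom.id k E)) = n)
    (ρ ρ' : E →ₐ[k] A) (hρinj : Function.Injective ρ) (hρ'inj : Function.Injective ρ')
    (hρcompat : ∀ e : E, τ (ρ e) = ρ (σ e))
    (hρ'compat : ∀ e : E, τ (ρ' e) = ρ' (σ e)) :
    ∃ g : Aˣ, ∀ x : E, ρ' x = (g : A) * ρ x * ((g⁻¹ : Aˣ) : A) := by
  have : Nontrivial A := Module.nontrivial_of_finrank_pos (R := k) (by rw [hdimA]; positivity)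
  have : IsSimpleRing A := ⟨⟨hsimple⟩⟩
  have : Algebra.IsCentral k A := ⟨fun a ha => by
    obtain ⟨c, rfl⟩ := hcentral a fun b => (Subalgebra.mem_center_iff.mp ha b).symm
    exact Subalgebra.algebraMap_mem _ c⟩
  obtain ⟨ι, _, K, _, _, e, hK⟩ := (Algebra.Etale.iff_exists_algEquiv_prod k E).mp inferInstance
  have := fun i => (hK i).1
  have := Fintype.ofFinite ι
  classical
  obtain ⟨g, hg⟩ := AlgHom.exists_unit_conj_of_pi (ρ := ρ.comp e.symm.toAlgHom)
    (ρ' := ρ'.comp e.symm.toAlgHom) (hρinj.comp e.symm.injective) (hρ'inj.comp e.symm.injective)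
    (by rw [hdimA, ← hdimE, e.toLinearEquiv.finrank_eq])
  exact ⟨g, fun x => by simpa using hg (e x)⟩
end

section
/- (Hilbert 90 for étale algebras with involution) Every f ∈ E^× with f·σ(f) = 1 is of the form f = e·σ(e)^{-1} for some e ∈ E^×. -/
universe u

/-- In a reduced Artinian commutative ring every element is von Neumann regular. -/
theorem exists_mul_mul_eq_self_of_isArtinianRing {R : Type*} [CommRing R] [IsArtinianRing R]
    [IsReduced R] (v : R) : ∃ w : R, v * w * v = v := by
  obtain ⟨m, w, hw⟩ := IsArtinian.exists_pow_succ_smul_dvd v (1 : R)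
  have hw' : v ^ m.succ * w = v ^ m := by simpa using hw
  refine ⟨w, ?_⟩
  have hpow : (v - v * w * v) ^ (m + 1) = 0 := by
    have hfactor : v - v * w * v = v * (1 - v * w) := by ring
    have hzero : v ^ m * (1 - v * w) = 0 := by
      rw [mul_sub, mul_one, ← mul_assoc, ← pow_succ, hw', sub_self]
    rw [hfactor, mul_pow, pow_succ, pow_succ (1 - v * w)]
    linear_combination v * (1 - v * w) ^ m * hzero
  exact (sub_eq_zero.mp (pow_eq_zero_iff (Nat.succ_ne_zero m) |>.mp hpow)).symm

/-- If `f * σ f = 1`, some solution `v` of `v = f * σ v` generates an ideal containing all the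
elements `a + f * σ a`, in the form that `1 - v * w` annihilates them for some `w`. -/
theorem exists_eq_mul_involution_of_maximal_support {R : Type*} [CommRing R] [IsArtinianRing R]
    [IsReduced R] (σ : R ≃+* R) (hσ : ∀ x, σ (σ x) = x) (f : R) (hf : f * σ f = 1) :
    ∃ v w : R, v = f * σ v ∧ ∀ a, (1 - v * w) * (a + f * σ a) = 0 := by
  obtain ⟨I, ⟨v, hv, rfl⟩, hmax⟩ := WellFounded.has_min
    (wellFounded_gt (α := Ideal R)) {I | ∃ v, v = f * σ v ∧ I = Ideal.span {v}}
    ⟨_, 0, by simp, rfl⟩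
  obtain ⟨w, hw⟩ := exists_mul_mul_eq_self_of_isArtinianRing v
  have hσv : σ v = σ f * v := by
    conv_lhs => rw [hv, map_mul, hσ]
  have hle : v * w * σ (v * w) = σ (v * w) := by
    rw [map_mul, hσv]
    linear_combination σ f * σ w * hw
  have hg : σ (v * w) = v * w := by
    have hle' := congrArg σ hle
    rw [map_mul, hσ, mul_comm, hle] at hle'
    exact hle'
  refine ⟨v, w, hv, fun a => ?_⟩
  by_contra hz
  set z := (1 - v * w) * (a + f * σ a) with hz_def
  have hgz : v * w * z = 0 := by
    rw [hz_def]
    linear_combination -w * (a + f * σ a) * hw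
  have hσz : z = f * σ z := by
    rw [hz_def, map_mul, map_sub, hg, map_one, map_add, map_mul, hσ]
    linear_combination -(1 - v * w) * a * hf
  refine hmax _ ⟨v + z, ?_, rfl⟩ (lt_of_le_not_ge ?_ ?_)
  · rw [map_add, mul_add, ← hv, ← hσz]
  · rw [Ideal.span_singleton_le_span_singleton]
    exact ⟨v * w, by linear_combination -hw - hgz⟩
  · rw [Ideal.span_singleton_le_span_singleton]
    rintro ⟨c, hc⟩
    apply hz
    linear_combination (1 - v * w) * hc + hgz + (1 - c) * hw

/-- An involution of a reduced finite-dimensional algebra whose fixed subalgebra has half the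
dimension admits an invertible antisymmetric element. -/
theorem exists_isUnit_involution_eq_neg {k E : Type*} [Field k] [CommRing E] [Algebra k E]
    [IsReduced E] [FiniteDimensional k E] (hchar : (2 : k) ≠ 0) (n : ℕ)
    (hdim : Module.finrank k E = 2 * n) (σ : E ≃ₐ[k] E) (hσ : ∀ x, σ (σ x) = x)
    (hfix : Module.finrank k ↥(AlgHom.equalizer σ.toAlgHom (AlgHom.id k E)) = n) :
    ∃ u : E, IsUnit u ∧ σ u = -u := by
  have : IsArtinianRing E := IsArtinianRing.of_finite k E
  obtain ⟨u, w, hu, hmax⟩ := exists_eq_mul_involution_of_maximal_support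
    σ.toRingEquiv hσ (-1) (by simp)
  have hu' : σ u = -u := by
    have hu'' : u = -1 * σ u := hu
    linear_combination hu''
  replace hmax : ∀ a, (1 - u * w) * (a + -1 * σ a) = 0 := hmax
  let T : E →ₗ[k] E := LinearMap.id - σ.toLinearMap
  let A : Submodule k E := Subalgebra.toSubmodule (AlgHom.equalizer σ.toAlgHom (AlgHom.id k E))
  have hA : ∀ x, x ∈ A ↔ σ x = x := fun x => Iff.rfl
  have hker : LinearMap.ker T = A := by
    ext x
    rw [LinearMap.mem_ker, hA]
    change x - σ x = 0 ↔ _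
    rw [sub_eq_zero, eq_comm]
  have hfinA : Module.finrank k A = n := hfix
  have hrange : Module.finrank k (LinearMap.range T) = n := by
    have hrn := T.finrank_range_add_finrank_ker
    rw [hker] at hrn
    omega
  have hanti : ∀ x ∈ LinearMap.range T, σ x = -x := by
    rintro _ ⟨y, rfl⟩
    change σ (y - σ y) = -(y - σ y)
    rw [map_sub, hσ, neg_sub]
  let L : LinearMap.range T →ₗ[k] A :=
    ((LinearMap.mulLeft k u).comp (LinearMap.range T).subtype).codRestrict A fun x => by
      rw [hA]
      change σ (u * x) = u * x
      rw [map_mul, hu', hanti x x.2, neg_mul_neg]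
  have hinj : Function.Injective L := by
    rw [injective_iff_map_eq_zero]
    intro x hx
    have hux : u * (x : E) = 0 := congrArg Subtype.val hx
    have hx2 : (2 : k) • (x : E) = 0 := by
      have hmx := hmax x
      rw [hanti x x.2] at hmx
      rw [ofNat_smul_eq_nsmul, two_nsmul]
      linear_combination hmx + 2 * w * hux
    exact Subtype.ext ((smul_eq_zero_iff_right hchar).mp hx2)
  obtain ⟨y, hy⟩ := (LinearMap.injective_iff_surjective_of_finrank_eq_finrank
    (hrange.trans hfinA.symm)).mp hinj ⟨1, (hA 1).mpr (map_one σ)⟩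
  exact ⟨u, IsUnit.of_mul_eq_one (y : E) (congrArg Subtype.val hy), hu'⟩

/-- Hilbert 90 for étale algebras with involution.  Let `E` be an étale
`k`-algebra of dimension `2n` with involution `σ` whose fixed subalgebra has dimension `n`.
Every `f ∈ E^×` with `f·σ(f) = 1` is of the form `f = e·σ(e)⁻¹` for some `e ∈ E^×`. -/
theorem stmt9 (k E : Type u) [Field k] [CommRing E] [Algebra k E]
    (hchar : (2 : k) ≠ 0)
    [Algebra.Etale k E] [FiniteDimensional k E]
    (n : ℕ) (hn : 1 ≤ n) (hdim : Module.finrank k E = 2 * n)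
    (σ : E ≃ₐ[k] E) (hσ : ∀ x, σ (σ x) = x)
    (hfix : Module.finrank k ↥(AlgHom.equalizer σ.toAlgHom (AlgHom.id k E)) = n)
    (f : E) (hf : IsUnit f) (hnorm : f * σ f = 1) :
    ∃ e : E, IsUnit e ∧ f = e * Ring.inverse (σ e) := by
  have : IsReduced E := Algebra.FormallyUnramified.isReduced_of_field k E
  have : IsArtinianRing E := IsArtinianRing.of_finite k E
  obtain ⟨u, hu, hσu⟩ := exists_isUnit_involution_eq_neg hchar n hdim σ hσ hfix
  obtain ⟨v, w, hv, hmax⟩ := exists_eq_mul_involution_of_maximal_support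
    σ.toRingEquiv hσ f hnorm
  replace hv : v = f * σ v := hv
  replace hmax : ∀ a, (1 - v * w) * (a + f * σ a) = 0 := hmax
  have h_one := hmax 1
  have h_anti := hmax u
  rw [map_one] at h_one
  rw [hσu] at h_anti
  have htwo : IsUnit (2 : E) := by
    simpa only [map_ofNat] using (IsUnit.mk0 (2 : k) hchar).map (algebraMap k E)
  have hvw : v * w = 1 := by
    have hzero : (2 * u) * (1 - v * w) = 0 := by
      linear_combination h_anti + u * h_one
    exact (sub_eq_zero.mp ((htwo.mul hu).mul_right_eq_zero.mp hzero)).symm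
  have hvu : IsUnit v := IsUnit.of_mul_eq_one w hvw
  refine ⟨v, hvu, ?_⟩
  rw [Ring.eq_mul_inverse_iff_mul_eq _ _ _ (hvu.map σ)]
  exact hv.symm
end

section
/- If e, e' ∈ E^× satisfy e·σ(e)^{-1} = e'·σ(e')^{-1}, then N_{E/k}(e)·N_{E/k}(e')^{-1} is a square in k^×. Consequently the rule e·σ(e)^{-1} ↦ N_{E/k}(e) gives a well-defined map from {f ∈ E^× : f·σ(f) = 1} to k^×/(k^×)². -/
universe u

/-- A reduced Artinian commutative ring is von Neumann regular. -/
theorem exists_eq_sq_mul_of_isReduced_of_isArtinianRing {R : Type*} [CommRing R] [IsReduced R]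
    [IsArtinianRing R] (r : R) : ∃ y, r = r ^ 2 * y := by
  obtain ⟨m, y, hy⟩ := IsArtinian.exists_pow_succ_smul_dvd r (1 : R)
  simp only [smul_eq_mul, mul_one, Nat.succ_eq_add_one] at hy
  refine ⟨y, sub_eq_zero.mp (IsReduced.eq_zero _ ⟨m + 1, ?_⟩)⟩
  have h : r - r ^ 2 * y = r * (1 - r * y) := by ring
  have h0 : r ^ m * (1 - r * y) = 0 := by
    linear_combination -hy
  rw [h, mul_pow, pow_succ r, pow_succ (1 - r * y)]
  linear_combination r * (1 - r * y) ^ m * h0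

/-- In a reduced Artinian commutative ring with involution `σ`, some anti-invariant element acts
injectively on the anti-invariant elements. -/
theorem exists_antiinvariant_mul_injective {R : Type*} [CommRing R] [IsReduced R]
    [IsArtinianRing R] (σ : R →+* R) :
    ∃ d : R, σ d = -d ∧ ∀ x, σ x = -x → d * x = 0 → x = 0 := by
  obtain ⟨_, ⟨d, hd, rfl⟩, hmax⟩ := set_has_maximal_iff_noetherian.mpr
    (inferInstance : IsNoetherian R R)
    {I : Ideal R | ∃ d, σ d = -d ∧ Ideal.span {d} = I} ⟨_, 0, by simp, rfl⟩
  refine ⟨d, hd, fun x hx hdx => ?_⟩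
  obtain ⟨y, hy⟩ := exists_eq_sq_mul_of_isReduced_of_isArtinianRing d
  obtain ⟨z, hz⟩ := exists_eq_sq_mul_of_isReduced_of_isArtinianRing x
  have hd_mem : d ∈ Ideal.span {d + x} :=
    Ideal.mem_span_singleton.mpr ⟨d * y, by linear_combination hy - y * hdx⟩
  have hx_mem : x ∈ Ideal.span {d + x} :=
    Ideal.mem_span_singleton.mpr ⟨x * z, by linear_combination hz - z * hdx⟩
  have hle : Ideal.span {d} ≤ Ideal.span {d + x} := by
    rwa [Ideal.span_singleton_le_iff_mem]
  have hxd : x ∈ Ideal.span {d} := by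
    by_contra hn
    exact hmax _ ⟨d + x, by rw [map_add, hd, hx, neg_add], rfl⟩
      (lt_of_le_not_ge hle fun h => hn (h hx_mem))
  obtain ⟨g, hg⟩ := Ideal.mem_span_singleton.mp hxd
  refine IsReduced.eq_zero _ ⟨2, ?_⟩
  linear_combination x * hg + g * hdx

/-- If the invariants of an involution `σ` have half the dimension of a reduced finite-dimensional
algebra, then there is an anti-invariant unit. -/
theorem exists_isUnit_antiinvariant {k E : Type*} [Field k] [CommRing E] [Algebra k E]
    [IsReduced E] [FiniteDimensional k E] (n : ℕ) (hdim : Module.finrank k E = 2 * n)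
    (σ : E ≃ₐ[k] E) (hσ : ∀ x, σ (σ x) = x)
    (hfix : Module.finrank k ↥(AlgHom.equalizer σ.toAlgHom (AlgHom.id k E)) = n) :
    ∃ d : E, IsUnit d ∧ σ d = -d := by
  have : IsArtinianRing E := IsArtinianRing.of_finite k E
  obtain ⟨d, hd, hinj⟩ := exists_antiinvariant_mul_injective (σ : E →+* E)
  have hd : σ d = -d := hd
  let F := Subalgebra.toSubmodule (AlgHom.equalizer σ.toAlgHom (AlgHom.id k E))
  have hF : ∀ x, x ∈ F ↔ σ x = x := fun x => Iff.rfl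
  have hFn : Module.finrank k F = n := hfix
  let T : E →ₗ[k] E := LinearMap.mulLeft k d ∘ₗ (LinearMap.id - σ.toLinearMap)
  have hT : ∀ x, T x = d * (x - σ x) := fun x => rfl
  have hker : LinearMap.ker T = F := by
    ext x
    rw [LinearMap.mem_ker, hT, hF]
    refine ⟨fun h => ?_, fun h => by rw [h, sub_self, mul_zero]⟩
    have := hinj (x - σ x) (by simp [hσ]) h
    exact (sub_eq_zero.mp this).symm
  have hrange : LinearMap.range T ≤ F := by
    rintro _ ⟨x, rfl⟩
    rw [hT, hF, map_mul, map_sub, hσ, hd]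
    ring
  have hrank := LinearMap.finrank_range_add_finrank_ker T
  rw [hker, hFn, hdim] at hrank
  have heq : LinearMap.range T = F :=
    Submodule.eq_of_le_of_finrank_eq hrange (by omega)
  obtain ⟨x, hx⟩ : (1 : E) ∈ LinearMap.range T := by
    rw [heq, hF, map_one]
  exact ⟨d, IsUnit.of_mul_eq_one _ hx, hd⟩

/-- If the invariants of an involution `σ` have half the dimension of a reduced finite-dimensional
algebra, then the norm of an invariant element is the square of its norm from the invariants. -/
theorem norm_eq_norm_equalizer_sq {k E : Type*} [Field k] [CommRing E] [Algebra k E]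
    (hchar : (2 : k) ≠ 0) [IsReduced E] [FiniteDimensional k E]
    (n : ℕ) (hdim : Module.finrank k E = 2 * n)
    (σ : E ≃ₐ[k] E) (hσ : ∀ x, σ (σ x) = x)
    (hfix : Module.finrank k ↥(AlgHom.equalizer σ.toAlgHom (AlgHom.id k E)) = n)
    (u : AlgHom.equalizer σ.toAlgHom (AlgHom.id k E)) :
    Algebra.norm k (u : E) = Algebra.norm k u ^ 2 := by
  obtain ⟨d, hdu, hd⟩ := exists_isUnit_antiinvariant n hdim σ hσ hfix
  let F := AlgHom.equalizer σ.toAlgHom (AlgHom.id k E)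
  have hF : ∀ x : F, σ x = x := fun x => x.2
  let φ : (F × F) →ₗ[k] E :=
    F.val.toLinearMap.coprod (LinearMap.mulLeft k d ∘ₗ F.val.toLinearMap)
  have hφ : ∀ p : F × F, φ p = p.1 + d * p.2 := fun p => rfl
  have hφinj : Function.Injective φ := by
    rw [← LinearMap.ker_eq_bot, LinearMap.ker_eq_bot']
    rintro ⟨a, b⟩ h
    rw [hφ] at h
    have h' := congrArg σ h
    simp only [map_add, map_mul, map_zero, hF, hd] at h h'
    have h2 : (2 : k) • (a : E) = 0 := by
      rw [two_smul]
      linear_combination h + h'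
    have ha : (a : E) = 0 := (smul_eq_zero_iff_right hchar).mp h2
    have hb : (b : E) = 0 := by
      rw [ha, zero_add] at h
      exact hdu.mul_right_eq_zero.mp h
    exact Prod.ext (Subtype.ext ha) (Subtype.ext hb)
  have hfr : Module.finrank k (F × F) = Module.finrank k E := by
    rw [Module.finrank_prod, hdim, hfix, two_mul]
  let Φ := LinearEquiv.ofInjectiveOfFinrankEq φ hφinj hfr
  have hconj : Algebra.lmul k E (u : E) = (Φ : (F × F) →ₗ[k] E) ∘ₗ
      (LinearMap.prodMap (Algebra.lmul k F u) (Algebra.lmul k F u)) ∘ₗ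
        (Φ.symm : E →ₗ[k] (F × F)) := by
    ext x
    obtain ⟨p, rfl⟩ := Φ.surjective x
    have hΦ : ∀ p, Φ p = p.1 + d * p.2 := fun p => rfl
    rw [LinearMap.comp_apply, LinearMap.comp_apply, LinearEquiv.coe_coe, LinearEquiv.coe_coe,
      LinearEquiv.symm_apply_apply, hΦ, hΦ]
    simp only [LinearMap.prodMap_apply, Algebra.coe_lmul_eq_mul, LinearMap.mul_apply_apply,
      MulMemClass.coe_mul]
    ring
  rw [Algebra.norm_apply, Algebra.norm_apply, hconj, LinearMap.det_conj, LinearMap.det_prodMap, sq]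

/-- If `e, e' ∈ E^×` satisfy `e·σ(e)⁻¹ = e'·σ(e')⁻¹`, then
`N_{E/k}(e)·N_{E/k}(e')⁻¹` is a square in `k^×`.  Consequently the rule
`e·σ(e)⁻¹ ↦ N_{E/k}(e)` gives a well-defined map from `{f ∈ E^× : f·σ(f) = 1}` to
`k^×/(k^×)²`. -/
theorem stmt10 (k E : Type u) [Field k] [CommRing E] [Algebra k E]
    (hchar : (2 : k) ≠ 0)
    [Algebra.Etale k E] [FiniteDimensional k E]
    (n : ℕ) (hn : 1 ≤ n) (hdim : Module.finrank k E = 2 * n)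
    (σ : E ≃ₐ[k] E) (hσ : ∀ x, σ (σ x) = x)
    (hfix : Module.finrank k ↥(AlgHom.equalizer σ.toAlgHom (AlgHom.id k E)) = n)
    (e e' : E) (he : IsUnit e) (he' : IsUnit e')
    (heq : e * Ring.inverse (σ e) = e' * Ring.inverse (σ e')) :
    ∃ c : k, c ≠ 0 ∧ Algebra.norm k e = c ^ 2 * Algebra.norm k e' := by
  have : IsReduced E := Algebra.FormallyUnramified.isReduced_of_field k E
  obtain ⟨a, rfl⟩ := he
  obtain ⟨b, rfl⟩ := he'
  have hs : ∀ v : Eˣ, Ring.inverse (σ v) = σ (v⁻¹ : Eˣ) := fun v =>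
    Ring.inverse_unit (Units.map (σ : E →* E) v)
  rw [hs, hs] at heq
  have ha : σ (a : E) * σ (a⁻¹ : Eˣ) = 1 := by rw [← map_mul, a.mul_inv, map_one]
  have hb : (b : E) * (b⁻¹ : Eˣ) = 1 := b.mul_inv
  have hu : σ ((a : E) * (b⁻¹ : Eˣ)) = a * (b⁻¹ : Eˣ) := by
    rw [map_mul]
    linear_combination (-σ (a : E) * σ (b⁻¹ : Eˣ)) * hb
      + (-σ (a : E) * (b⁻¹ : Eˣ)) * heq + (a : E) * (b⁻¹ : Eˣ) * ha
  have hN := norm_eq_norm_equalizer_sq hchar n hdim σ hσ hfix ⟨a * (b⁻¹ : Eˣ), hu⟩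
  refine ⟨Algebra.norm k (⟨a * (b⁻¹ : Eˣ), hu⟩ :
    AlgHom.equalizer σ.toAlgHom (AlgHom.id k E)), fun h0 => ?_, ?_⟩
  · rw [h0, zero_pow two_ne_zero] at hN
    exact ((a * b⁻¹).isUnit.map (Algebra.norm k)).ne_zero hN
  · rw [← hN, ← map_mul, mul_assoc, b.inv_mul, mul_one]
end

section
/- There exists a unit δ ∈ E^× with σ(δ) = −δ. -/
universe u

/-- In a reduced algebra, if `x * y = 0` then anything killing `x + y` kills `x`. -/
theorem mul_eq_zero_of_mul_add_eq_zero {R : Type*} [CommRing R] [IsReduced R] {x y z : R}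
    (hxy : x * y = 0) (h : (x + y) * z = 0) : x * z = 0 := by
  refine IsReduced.eq_zero _ ⟨2, ?_⟩
  linear_combination x * z * h - z ^ 2 * hxy

/-- Every subspace `V` of a reduced finite-dimensional algebra contains an element `x` such that
multiplication by `x` is injective on `V`. -/
theorem exists_mem_forall_mul_eq_zero {k E : Type*} [Field k] [CommRing E] [Algebra k E]
    [FiniteDimensional k E] [IsReduced E] (V : Submodule k E) :
    ∃ x ∈ V, ∀ y ∈ V, x * y = 0 → y = 0 := by
  obtain ⟨_, ⟨x, hx, rfl⟩, hmin⟩ := IsArtinian.set_has_minimal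
    ((fun x : E => LinearMap.ker (LinearMap.mulLeft k x)) '' (V : Set E)) ⟨_, 0, V.zero_mem, rfl⟩
  refine ⟨x, hx, fun y hy hxy => ?_⟩
  by_contra hy0
  refine hmin _ ⟨x + y, V.add_mem hx hy, rfl⟩ (SetLike.lt_iff_le_and_exists.2 ⟨?_, y, ?_, ?_⟩)
  · intro z hz
    simp only [LinearMap.mem_ker, LinearMap.mulLeft_apply] at hz ⊢
    exact mul_eq_zero_of_mul_add_eq_zero hxy hz
  · simpa using hxy
  · simp only [LinearMap.mem_ker, LinearMap.mulLeft_apply, add_mul, hxy, zero_add]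
    exact fun h => hy0 (IsReduced.eq_zero _ ⟨2, by rw [sq, h]⟩)

/-- Let `E` be an étale `k`-algebra of dimension `2n` (char `k ≠ 2`) with
involution `σ` whose fixed subalgebra has dimension `n`.  Then there exists a unit
`δ ∈ E^×` with `σ(δ) = −δ`. -/
theorem stmt12 (k E : Type u) [Field k] [CommRing E] [Algebra k E]
    (hchar : (2 : k) ≠ 0)
    [Algebra.Etale k E] [FiniteDimensional k E]
    (n : ℕ) (hn : 1 ≤ n) (hdim : Module.finrank k E = 2 * n)
    (σ : E ≃ₐ[k] E) (hσ : ∀ x, σ (σ x) = x)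
    (hfix : Module.finrank k ↥(AlgHom.equalizer σ.toAlgHom (AlgHom.id k E)) = n) :
    ∃ δ : E, IsUnit δ ∧ σ δ = -δ := by
  have : IsReduced E := Algebra.FormallyUnramified.isReduced_of_field k E
  let T : E →ₗ[k] E := σ.toLinearMap - LinearMap.id
  have hT (x : E) : T x = σ x - x := rfl
  have hker : Module.finrank k (LinearMap.ker T) = n := by
    have h : LinearMap.ker T =
        Subalgebra.toSubmodule (AlgHom.equalizer σ.toAlgHom (AlgHom.id k E)) := by
      ext x
      simp [hT, sub_eq_zero]
    rw [h]
    exact hfix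
  have hrange : Module.finrank k (LinearMap.range T) = n := by
    have := T.finrank_range_add_finrank_ker
    lia
  have hneg : ∀ y ∈ LinearMap.range T, σ y = -y := by
    rintro _ ⟨z, rfl⟩
    simp [hT, hσ]
  obtain ⟨x, hx, hinj⟩ := exists_mem_forall_mul_eq_zero (LinearMap.range T)
  have hmaps : ∀ y ∈ LinearMap.range T, LinearMap.mulLeft k x y ∈ LinearMap.ker T := by
    intro y hy
    simp [hT, hneg x hx, hneg y hy]
  let φ : LinearMap.range T →ₗ[k] LinearMap.ker T := (LinearMap.mulLeft k x).restrict hmaps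
  have hφ : Function.Injective φ := by
    refine (injective_iff_map_eq_zero φ).2 fun y hy => Subtype.ext (hinj y y.2 ?_)
    exact congrArg Subtype.val hy
  obtain ⟨y, hy⟩ := (LinearMap.injective_iff_surjective_of_finrank_eq_finrank
    (hrange.trans hker.symm)).1 hφ ⟨1, by simp [hT]⟩
  exact ⟨x, .of_mul_eq_one (y : E) (congrArg Subtype.val hy), hneg x hx⟩
end

section
/- The relation on Φ defined by φ ~ φ' if and only if |φ ∩ φ'| is even is an equivalence relation on Φ with exactly two equivalence classes Φ+ and Φ−, each of cardinality 8, and each class is stable under the complement involution φ ↦ X ∖ φ (so that (Φ+, complement) and (Φ−, complement) are again 8-element sets with fixed-point-free involutions). -/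
/-- A *section* of a set with involution `ν` is a subset containing exactly one element of
each `ν`-orbit: `x ∈ φ ↔ ν x ∉ φ` for all `x`. -/
def IsSection {X : Type*} (ν : X → X) (φ : Finset X) : Prop :=
  ∀ x, x ∈ φ ↔ ν x ∉ φ

namespace IsSection

variable {X : Type*} {ν : X → X}

theorem exists_of_involutive [Fintype X] (hν2 : ∀ x, ν (ν x) = x) (hνfp : ∀ x, ν x ≠ x) :
    ∃ φ : Finset X, IsSection ν φ := by
  classical
  let e := Fintype.equivFin X
  refine ⟨Finset.univ.filter fun x => e x < e (ν x), fun x => ?_⟩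
  have h : e (ν x) ≠ e x := fun h => hνfp x (e.injective h)
  simp only [Finset.mem_filter, Finset.mem_univ, true_and, hν2, not_lt]
  exact ⟨le_of_lt, fun h' => lt_of_le_of_ne h' h.symm⟩

theorem compl [Fintype X] [DecidableEq X] {φ : Finset X} (h : IsSection ν φ) :
    IsSection ν φᶜ := by
  intro x
  have := h x
  simp only [Finset.mem_compl]
  tauto

theorem compl_ne [Fintype X] [DecidableEq X] [Nonempty X] (φ : Finset X) : φᶜ ≠ φ := by
  intro h
  obtain ⟨x⟩ := ‹Nonempty X›
  have : x ∈ φᶜ ↔ x ∈ φ := by rw [h]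
  simp only [Finset.mem_compl] at this
  tauto

theorem two_mul_card [Fintype X] [DecidableEq X] (hν2 : ∀ x, ν (ν x) = x)
    {φ : Finset X} (h : IsSection ν φ) : 2 * φ.card = Fintype.card X := by
  have hc : φ.card = φᶜ.card := by
    refine Finset.card_nbij' ν ν ?_ ?_ (fun x _ => hν2 x) (fun x _ => hν2 x)
    · intro x hx
      simpa using (h x).1 hx
    · intro x hx
      have hx : x ∉ φ := by simpa using hx
      have := h x
      simp only [Finset.mem_coe]
      tauto
  have := φ.card_add_card_compl
  omega

theorem card_inter_sdiff [DecidableEq X] (hν2 : ∀ x, ν (ν x) = x) {φ₁ φ₂ φ₃ : Finset X}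
    (h₁ : IsSection ν φ₁) (h₂ : IsSection ν φ₂) (h₃ : IsSection ν φ₃) :
    ((φ₁ ∩ φ₂) \ φ₃).card = (φ₃ \ (φ₁ ∪ φ₂)).card := by
  refine Finset.card_nbij' ν ν ?_ ?_ (fun x _ => hν2 x) (fun x _ => hν2 x) <;>
  · intro x
    have := h₁ x
    have := h₂ x
    have := h₃ x
    simp only [Finset.coe_sdiff, Finset.coe_inter, Finset.coe_union, Set.mem_sdiff,
      Set.mem_inter_iff, Set.mem_union, Finset.mem_coe]
    tauto

theorem card_inter_add_card_inter [DecidableEq X] (hν2 : ∀ x, ν (ν x) = x)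
    {φ₁ φ₂ φ₃ : Finset X}
    (h₁ : IsSection ν φ₁) (h₂ : IsSection ν φ₂) (h₃ : IsSection ν φ₃) :
    (φ₁ ∩ φ₂).card + (φ₁ ∩ φ₃).card + (φ₂ ∩ φ₃).card =
      φ₃.card + 2 * (φ₁ ∩ φ₂ ∩ φ₃).card := by
  have e₁ := card_inter_sdiff hν2 h₁ h₂ h₃
  have e₂ := Finset.card_sdiff_add_card_inter (φ₁ ∩ φ₂) φ₃
  have e₃ := Finset.card_sdiff_add_card_inter φ₃ (φ₁ ∪ φ₂)
  have e₄ := Finset.card_union_add_card_inter (φ₁ ∩ φ₃) (φ₂ ∩ φ₃)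
  have e₅ : φ₃ ∩ (φ₁ ∪ φ₂) = φ₁ ∩ φ₃ ∪ φ₂ ∩ φ₃ := by
    rw [Finset.inter_comm, Finset.union_inter_distrib_right]
  have e₆ : φ₁ ∩ φ₃ ∩ (φ₂ ∩ φ₃) = φ₁ ∩ φ₂ ∩ φ₃ := (Finset.inter_inter_distrib_right ..).symm
  rw [e₅] at e₃
  rw [e₆] at e₄
  omega

open Classical in
theorem card_filter_card_inter [Fintype X] (hν2 : ∀ x, ν (ν x) = x)
    {φ₀ : Finset X} (h₀ : IsSection ν φ₀) (P : ℕ → Prop) :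
    (Finset.univ.filter fun φ : Finset X => IsSection ν φ ∧ P (φ ∩ φ₀).card).card =
      ∑ k ∈ Finset.range (φ₀.card + 1), φ₀.card.choose k • if P k then 1 else 0 := by
  rw [← Finset.sum_powerset_apply_card (fun k => if P k then 1 else 0), ← Finset.card_filter]
  refine Finset.card_nbij (· ∩ φ₀) ?_ ?_ ?_
  · intro φ hφ
    simp_all
  · intro φ hφ φ' hφ' h
    simp only [Finset.coe_filter, Finset.mem_univ, true_and, Set.mem_ofPred_eq] at hφ hφ'
    ext x
    have hx := Finset.ext_iff.1 h x
    have hy := Finset.ext_iff.1 h (ν x)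
    simp only [Finset.mem_inter] at hx hy
    have := hφ.1 x
    have := hφ'.1 x
    have := h₀ x
    tauto
  · intro s hs
    simp only [Finset.coe_filter, Finset.mem_powerset, Set.mem_ofPred_eq] at hs
    obtain ⟨hs, hP⟩ := hs
    have hi : (Finset.univ.filter fun x => x ∈ s ∨ (x ∉ φ₀ ∧ ν x ∉ s)) ∩ φ₀ = s := by
      ext x
      have := @hs x
      simp only [Finset.mem_inter, Finset.mem_filter, Finset.mem_univ, true_and]
      tauto
    refine ⟨Finset.univ.filter fun x => x ∈ s ∨ (x ∉ φ₀ ∧ ν x ∉ s), ?_, hi⟩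
    simp only [Finset.coe_filter, Finset.mem_univ, true_and, Set.mem_ofPred_eq]
    refine ⟨fun x => ?_, by rwa [hi]⟩
    have := @hs x
    have := @hs (ν x)
    have := h₀ x
    simp only [Finset.mem_filter, Finset.mem_univ, true_and, hν2]
    tauto

end IsSection

/-- Let `X` be an 8-element set with a fixed-point-free involution `ν`, and
let `Φ` be the 16-element set of sections of `(X,ν)`.  The relation `φ ~ φ'` iff `|φ ∩ φ'|`
is even is an equivalence relation on `Φ` with exactly two equivalence classes `Φ+` and `Φ−`,
each of cardinality 8, and each class is stable under the complement involution
`φ ↦ X ∖ φ`, which moreover has no fixed points among sections. -/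
theorem stmt13 (X : Type*) [Fintype X] [DecidableEq X]
    (hX : Fintype.card X = 8)
    (ν : X → X) (hν2 : ∀ x, ν (ν x) = x) (hνfp : ∀ x, ν x ≠ x) :
    -- the relation is reflexive, symmetric and transitive on sections
    (∀ φ : Finset X, IsSection ν φ → Even (φ ∩ φ).card) ∧
    (∀ φ φ' : Finset X, IsSection ν φ → IsSection ν φ' →
      Even (φ ∩ φ').card → Even (φ' ∩ φ).card) ∧
    (∀ φ₁ φ₂ φ₃ : Finset X, IsSection ν φ₁ → IsSection ν φ₂ → IsSection ν φ₃ →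
      Even (φ₁ ∩ φ₂).card → Even (φ₂ ∩ φ₃).card → Even (φ₁ ∩ φ₃).card) ∧
    -- there are exactly two equivalence classes `Φ+`, `Φ−`, each of cardinality 8,
    -- stable under complementation; and complementation has no fixed sections
    (∃ Φp Φm : Finset (Finset X),
      Φp.card = 8 ∧ Φm.card = 8 ∧ Disjoint Φp Φm ∧
      (∀ φ : Finset X, IsSection ν φ ↔ (φ ∈ Φp ∨ φ ∈ Φm)) ∧
      (∀ φ ∈ Φp, ∀ φ' ∈ Φp, Even (φ ∩ φ').card) ∧
      (∀ φ ∈ Φm, ∀ φ' ∈ Φm, Even (φ ∩ φ').card) ∧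
      (∀ φ ∈ Φp, ∀ φ' ∈ Φm, ¬ Even (φ ∩ φ').card) ∧
      (∀ φ ∈ Φp, φᶜ ∈ Φp) ∧ (∀ φ ∈ Φm, φᶜ ∈ Φm)) ∧
    (∀ φ : Finset X, IsSection ν φ → IsSection ν φᶜ ∧ φᶜ ≠ φ) := by
  classical
  have hcard : ∀ φ : Finset X, IsSection ν φ → φ.card = 4 := fun φ h => by
    have := h.two_mul_card hν2
    omega
  have : Nonempty X := Fintype.card_pos_iff.1 (by omega)
  have key : ∀ φ₁ φ₂ φ₃ : Finset X, IsSection ν φ₁ → IsSection ν φ₂ → IsSection ν φ₃ →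
      (Even (φ₁ ∩ φ₂).card ↔ (Even (φ₁ ∩ φ₃).card ↔ Even (φ₂ ∩ φ₃).card)) := by
    intro φ₁ φ₂ φ₃ h₁ h₂ h₃
    have := h₁.card_inter_add_card_inter hν2 h₂ h₃
    rw [hcard φ₃ h₃] at this
    grind
  obtain ⟨φ₀, h₀⟩ := IsSection.exists_of_involutive hν2 hνfp
  have hcompl : ∀ φ : Finset X, Even (φᶜ ∩ φ₀).card ↔ Even (φ ∩ φ₀).card := by
    intro φ
    have e₁ := Finset.card_sdiff_add_card_inter φ₀ φ
    have e₂ : φᶜ ∩ φ₀ = φ₀ \ φ := by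
      rw [Finset.sdiff_eq_inter_compl, Finset.inter_comm]
    rw [hcard φ₀ h₀, ← e₂, Finset.inter_comm φ₀] at e₁
    grind
  refine ⟨?_, ?_, ?_, ?_, fun φ h => ⟨h.compl, IsSection.compl_ne φ⟩⟩
  · intro φ h
    rw [Finset.inter_self, hcard φ h]
    decide
  · intro φ φ' _ _ h
    rwa [Finset.inter_comm]
  · intro φ₁ φ₂ φ₃ h₁ h₂ h₃ h₁₂ h₂₃
    exact ((key φ₁ φ₂ φ₃ h₁ h₂ h₃).1 h₁₂).2 h₂₃
  · refine ⟨Finset.univ.filter fun φ => IsSection ν φ ∧ Even (φ ∩ φ₀).card,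
      Finset.univ.filter fun φ => IsSection ν φ ∧ ¬ Even (φ ∩ φ₀).card,
      ?_, ?_, ?_, ?_, ?_, ?_, ?_, ?_, ?_⟩
    · have h := IsSection.card_filter_card_inter hν2 h₀ (fun n => Even n)
      rw [hcard φ₀ h₀] at h
      convert h
      simp [Finset.sum_range_succ, Nat.choose, show ¬ Even 3 by decide, show Even 4 by decide]
    · have h := IsSection.card_filter_card_inter hν2 h₀ (fun n => ¬ Even n)
      rw [hcard φ₀ h₀] at h
      convert h
      simp [Finset.sum_range_succ, Nat.choose, show ¬ Odd 2 by decide, show Odd 3 by decide,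
        show ¬ Odd 4 by decide]
    · rw [Finset.disjoint_filter]
      tauto
    · intro φ
      simp only [Finset.mem_filter, Finset.mem_univ, true_and, ← and_or_left, em, and_true]
    all_goals simp only [Finset.mem_filter, Finset.mem_univ, true_and]
    · rintro φ ⟨h, hp⟩ φ' ⟨h', hp'⟩
      have := key φ φ' φ₀ h h' h₀
      tauto
    · rintro φ ⟨h, hp⟩ φ' ⟨h', hp'⟩
      have := key φ φ' φ₀ h h' h₀
      tauto
    · rintro φ ⟨h, hp⟩ φ' ⟨h', hp'⟩
      have := key φ φ' φ₀ h h' h₀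
      tauto
    · exact fun φ ⟨h, hp⟩ => ⟨h.compl, (hcompl φ).2 hp⟩
    · exact fun φ ⟨h, hp⟩ => ⟨h.compl, fun hq => hp ((hcompl φ).1 hq)⟩
end

section
/- The map Ψ : X ⊔ Φ− → Sections(Φ+, complement) defined by Ψ(ρ) = {φ ∈ Φ+ : ρ ∈ φ} for ρ ∈ X and Ψ(φ') = {φ ∈ Φ+ : |φ ∩ φ'| = 1} for φ' ∈ Φ− is a well-defined bijection from the disjoint union X ⊔ Φ− onto the set of sections of (Φ+, complement). Moreover Ψ is equivariant with respect to any permutation g of X that commutes with ν and whose induced action on Φ preserves Φ+ (g acts on sections of Φ+ via its action on Φ+). The analogous statement holds with the roles of Φ+ and Φ− interchanged. -/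
/-- A *section* of `(Φ⁺, complement)`: a subset `S ⊆ Φ⁺` containing exactly one of `φ`,
`X ∖ φ` for each `φ ∈ Φ⁺`. -/
def IsSectionOf {X : Type*} [Fintype X] [DecidableEq X]
    (Φp : Finset (Finset X)) (S : Finset (Finset X)) : Prop :=
  S ⊆ Φp ∧ ∀ φ ∈ Φp, (φ ∈ S ↔ φᶜ ∉ S)

/-- The map `Ψ : X ⊔ Φ⁻ → Sections(Φ⁺, complement)`:
`Ψ(ρ) = {φ ∈ Φ⁺ : ρ ∈ φ}` for `ρ ∈ X`, and
`Ψ(φ') = {φ ∈ Φ⁺ : |φ ∩ φ'| = 1}` for `φ' ∈ Φ⁻`. -/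
def Psi {X : Type*} [Fintype X] [DecidableEq X] (Φp Φm : Finset (Finset X)) :
    X ⊕ {φ : Finset X // φ ∈ Φm} → Finset (Finset X)
  | Sum.inl ρ => Φp.filter fun φ => ρ ∈ φ
  | Sum.inr φ' => Φp.filter fun φ => (φ ∩ φ'.1).card = 1

section Reflex

variable {X : Type*} [DecidableEq X]

theorem exists_mem_image_eq {Φp : Finset (Finset X)} (g : X ≃ X)
    (hg : ∀ φ ∈ Φp, φ.image ⇑g ∈ Φp) {ψ : Finset X} (hψ : ψ ∈ Φp) : ∃ φ ∈ Φp, φ.image ⇑g = ψ := by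
  have hsub : Φp.image (fun φ => φ.image ⇑g) ⊆ Φp := Finset.image_subset_iff.2 hg
  have heq := Finset.eq_of_subset_of_card_le hsub
    (Finset.card_image_of_injective Φp (Finset.image_injective g.injective)).ge
  exact Finset.mem_image.1 (heq.symm.subset hψ)

theorem image_filter_of_image_iff {Φp : Finset (Finset X)} (g : X ≃ X)
    (hg : ∀ φ ∈ Φp, φ.image ⇑g ∈ Φp) (p q : Finset X → Prop) [DecidablePred p] [DecidablePred q]
    (hpq : ∀ φ, q (φ.image ⇑g) ↔ p φ) :
    (Φp.filter p).image (fun φ => φ.image ⇑g) = Φp.filter q := by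
  ext ψ
  simp only [Finset.mem_image, Finset.mem_filter]
  constructor
  · rintro ⟨φ, ⟨hφ, hp⟩, rfl⟩
    exact ⟨hg φ hφ, (hpq φ).2 hp⟩
  · rintro ⟨hψ, hq⟩
    obtain ⟨φ, hφ, rfl⟩ := exists_mem_image_eq g hg hψ
    exact ⟨φ, ⟨hφ, (hpq φ).1 hq⟩, rfl⟩

variable [Fintype X]

/-- `Φp` and `Φm` are the two parity classes of sections of the fixed-point-free involution `ν`
on an 8-element set. -/
structure IsParityPartition (ν : X → X) (Φp Φm : Finset (Finset X)) : Prop where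
  card_eq : Fintype.card X = 8
  invol : ∀ x, ν (ν x) = x
  ne_self : ∀ x, ν x ≠ x
  card_left : Φp.card = 8
  card_right : Φm.card = 8
  isSection_iff : ∀ φ : Finset X, IsSection ν φ ↔ (φ ∈ Φp ∨ φ ∈ Φm)
  even_left : ∀ φ ∈ Φp, ∀ φ' ∈ Φp, Even (φ ∩ φ').card
  even_right : ∀ φ ∈ Φm, ∀ φ' ∈ Φm, Even (φ ∩ φ').card
  not_even : ∀ φ ∈ Φp, ∀ φ' ∈ Φm, ¬ Even (φ ∩ φ').card
  compl_left : ∀ φ ∈ Φp, φᶜ ∈ Φp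
  compl_right : ∀ φ ∈ Φm, φᶜ ∈ Φm

/-- A section is determined by its intersection with any fixed section. -/
theorem IsSectionOf.eq_of_inter_eq {Φp S S' T : Finset (Finset X)} (hS : IsSectionOf Φp S)
    (hT : IsSectionOf Φp T) (hS' : IsSectionOf Φp S')
    (heq : S ∩ T = S' ∩ T) : S = S' := by
  have hiff : ∀ φ ∈ T, (φ ∈ S ↔ φ ∈ S') := fun φ hφ => by
    simpa [hφ] using Finset.ext_iff.1 heq φ
  ext φ
  by_cases hφ : φ ∈ Φp
  · by_cases hφT : φ ∈ T
    · exact hiff φ hφT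
    · have hc : φᶜ ∈ T := by_contra fun hc => hφT ((hT.2 φ hφ).2 hc)
      rw [hS.2 φ hφ, hS'.2 φ hφ, hiff _ hc]
  · exact iff_of_false (fun hs => hφ (hS.1 hs)) (fun hs => hφ (hS'.1 hs))

namespace IsParityPartition

variable {ν : X → X} {Φp Φm : Finset (Finset X)}

theorem symm (h : IsParityPartition ν Φp Φm) : IsParityPartition ν Φm Φp where
  card_eq := h.card_eq
  invol := h.invol
  ne_self := h.ne_self
  card_left := h.card_right
  card_right := h.card_left
  isSection_iff φ := (h.isSection_iff φ).trans or_comm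
  even_left := h.even_right
  even_right := h.even_left
  not_even φ hφ φ' hφ' := by
    rw [Finset.inter_comm]
    exact h.not_even φ' hφ' φ hφ
  compl_left := h.compl_right
  compl_right := h.compl_left

theorem mem_iff_left (h : IsParityPartition ν Φp Φm) {φ : Finset X} (hφ : φ ∈ Φp) (x : X) :
    x ∈ φ ↔ ν x ∉ φ :=
  (h.isSection_iff φ).2 (Or.inl hφ) x

theorem card_of_mem_left (h : IsParityPartition ν Φp Φm) {φ : Finset X} (hφ : φ ∈ Φp) :
    φ.card = 4 := by
  have himage : φ.image ν = φᶜ := by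
    ext x
    rw [Finset.mem_image, Finset.mem_compl]
    refine ⟨?_, fun hx => ⟨ν x, ?_, h.invol x⟩⟩
    · rintro ⟨y, hy, rfl⟩
      exact (h.mem_iff_left hφ y).1 hy
    · rwa [h.mem_iff_left hφ, h.invol]
  have hcard := Finset.card_image_of_injective φ (Function.LeftInverse.injective h.invol)
  rw [himage] at hcard
  have := Finset.card_add_card_compl φ
  have := h.card_eq
  lia

theorem card_inter_add_card_compl_inter (h : IsParityPartition ν Φp Φm) (φ : Finset X)
    {φ' : Finset X} (hφ' : φ' ∈ Φm) : (φ ∩ φ').card + (φᶜ ∩ φ').card = 4 := by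
  rw [← h.symm.card_of_mem_left hφ', Finset.inter_comm φ, Finset.inter_comm φᶜ,
    ← Finset.sdiff_eq_inter_compl]
  exact Finset.card_inter_add_card_sdiff φ' φ

theorem card_insert_erase_inter_self (h : IsParityPartition ν Φp Φm) {φ : Finset X}
    (hφ : φ ∈ Φm) {x : X} (hx : x ∈ φ) : (insert (ν x) (φ.erase x) ∩ φ).card = 3 := by
  rw [Finset.insert_inter_of_notMem ((h.symm.mem_iff_left hφ x).1 hx),
    Finset.inter_eq_left.2 (Finset.erase_subset x φ), Finset.card_erase_of_mem hx,
    h.symm.card_of_mem_left hφ]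

/-- Switching a section on a single orbit changes its parity class. -/
theorem insert_erase_mem (h : IsParityPartition ν Φp Φm) {φ : Finset X} (hφ : φ ∈ Φm) {x : X}
    (hx : x ∈ φ) : insert (ν x) (φ.erase x) ∈ Φp := by
  have hmem := h.symm.mem_iff_left hφ
  have hsec : IsSection ν (insert (ν x) (φ.erase x)) := by
    intro y
    have := h.invol x
    have := h.invol y
    have := h.ne_self x
    have := hmem y
    have := hmem x
    simp only [Finset.mem_insert, Finset.mem_erase]
    grind
  refine ((h.isSection_iff _).1 hsec).resolve_right fun hm => ?_
  have heven := h.even_right _ hm _ hφ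
  rw [h.card_insert_erase_inter_self hφ hx] at heven
  revert heven
  decide

theorem exists_mem_right (h : IsParityPartition ν Φp Φm) (x : X) : ∃ φ ∈ Φm, x ∈ φ := by
  obtain ⟨φ, hφ⟩ : Φm.Nonempty := Finset.card_pos.1 (by rw [h.card_right]; norm_num)
  by_cases hx : x ∈ φ
  · exact ⟨φ, hφ, hx⟩
  · exact ⟨φᶜ, h.compl_right φ hφ, Finset.mem_compl.2 hx⟩

theorem isSectionOf_psi (h : IsParityPartition ν Φp Φm) (z : X ⊕ {φ : Finset X // φ ∈ Φm}) :
    IsSectionOf Φp (Psi Φp Φm z) := by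
  rcases z with ρ | ⟨φ', hφ'⟩
  · refine ⟨Finset.filter_subset _ _, fun φ hφ => ?_⟩
    simp [Psi, hφ, h.compl_left φ hφ]
  · refine ⟨Finset.filter_subset _ _, fun φ hφ => ?_⟩
    have hsum := h.card_inter_add_card_compl_inter φ hφ'
    have hodd := h.not_even φ hφ φ' hφ'
    simp only [Psi, Finset.mem_filter, hφ, h.compl_left φ hφ, true_and]
    rw [Nat.even_iff] at hodd
    lia

theorem exists_mem_notMem (h : IsParityPartition ν Φp Φm) {x y : X} (hxy : x ≠ y) :
    ∃ φ ∈ Φp, x ∈ φ ∧ y ∉ φ := by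
  obtain ⟨φ, hφ, hx⟩ := h.exists_mem_right x
  by_cases hy : y ∈ φ
  · refine ⟨_, h.insert_erase_mem hφ hy, ?_, ?_⟩
    · simp [hx, hxy]
    · simp [(h.ne_self y).symm]
  · obtain ⟨z, hz⟩ : ((φ.erase x).erase (ν y)).Nonempty := by
      refine Finset.card_pos.1 ?_
      have h₁ := Finset.pred_card_le_card_erase (s := φ.erase x) (a := ν y)
      rw [Finset.card_erase_of_mem hx, h.symm.card_of_mem_left hφ] at h₁
      lia
    simp only [Finset.mem_erase] at hz
    have := h.invol z
    refine ⟨_, h.insert_erase_mem hφ hz.2.2, ?_, ?_⟩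
    · simp [hx, hz.2.1.symm]
    · simp only [Finset.mem_insert, Finset.mem_erase]
      grind

theorem psi_inl_ne_psi_inr (h : IsParityPartition ν Φp Φm) (ρ : X)
    (φ : {φ : Finset X // φ ∈ Φm}) : Psi Φp Φm (Sum.inl ρ) ≠ Psi Φp Φm (Sum.inr φ) := by
  obtain ⟨φ, hφ⟩ := φ
  intro heq
  suffices ∃ x ∈ φ, ρ ∈ insert (ν x) (φ.erase x) by
    obtain ⟨x, hx, hρ⟩ := this
    have hmem := Finset.ext_iff.1 heq (insert (ν x) (φ.erase x))
    have h₃ := h.card_insert_erase_inter_self hφ hx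
    simp only [Psi, Finset.mem_filter, h.insert_erase_mem hφ hx, true_and, h₃] at hmem
    simpa using hmem.1 hρ
  by_cases hρ : ρ ∈ φ
  · obtain ⟨x, hx⟩ : (φ.erase ρ).Nonempty := by
      refine Finset.card_pos.1 ?_
      rw [Finset.card_erase_of_mem hρ, h.symm.card_of_mem_left hφ]
      norm_num
    rw [Finset.mem_erase] at hx
    exact ⟨x, hx.2, by simp [hρ, hx.1.symm]⟩
  · have hνρ : ν ρ ∈ φ := by rwa [h.symm.mem_iff_left hφ, h.invol]
    exact ⟨ν ρ, hνρ, by simp [h.invol]⟩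

/-- Two distinct sections of the same class are separated by a section of the other class. -/
theorem exists_card_inter (h : IsParityPartition ν Φp Φm) {φ φ' : Finset X} (hφ : φ ∈ Φm)
    (hφ' : φ' ∈ Φm) (hne : φ ≠ φ') : ∃ ψ ∈ Φp, (ψ ∩ φ).card = 3 ∧ (ψ ∩ φ').card = 1 := by
  have hcard := h.symm.card_of_mem_left hφ
  have hcard' := h.symm.card_of_mem_left hφ'
  have heven := h.even_right φ hφ φ' hφ'
  have hlt : (φ ∩ φ').card < 4 := by
    refine lt_of_le_of_ne (hcard ▸ Finset.card_le_card Finset.inter_subset_left) fun h₄ => hne ?_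
    rw [← Finset.eq_of_subset_of_card_le (Finset.inter_subset_left (s₁ := φ) (s₂ := φ')) (by lia),
      Finset.inter_eq_right]
    rw [← Finset.eq_of_subset_of_card_le (Finset.inter_subset_right (s₁ := φ) (s₂ := φ')) (by lia)]
    exact Finset.inter_subset_left
  have hcases : (φ ∩ φ').card = 0 ∨ (φ ∩ φ').card = 2 := by
    rw [Nat.even_iff] at heven
    lia
  rcases hcases with h₀ | h₂
  · obtain ⟨x, hx⟩ : φ.Nonempty := Finset.card_pos.1 (by lia)
    refine ⟨_, h.insert_erase_mem hφ hx, h.card_insert_erase_inter_self hφ hx, ?_⟩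
    rw [Finset.card_eq_zero] at h₀
    have hx' : x ∉ φ' := fun hx' => by simpa [h₀] using Finset.mem_inter.2 ⟨hx, hx'⟩
    have hνx : ν x ∈ φ' := by rwa [h.symm.mem_iff_left hφ', h.invol]
    rw [Finset.insert_inter_of_mem hνx, Finset.erase_inter, h₀]
    simp
  · obtain ⟨x, hx⟩ : (φ ∩ φ').Nonempty := Finset.card_pos.1 (by lia)
    have hx₁ := (Finset.mem_inter.1 hx).1
    have hx₂ := (Finset.mem_inter.1 hx).2
    refine ⟨_, h.insert_erase_mem hφ hx₁, h.card_insert_erase_inter_self hφ hx₁, ?_⟩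
    rw [Finset.insert_inter_of_notMem ((h.symm.mem_iff_left hφ' x).1 hx₂), Finset.erase_inter,
      Finset.card_erase_of_mem hx, h₂]

theorem psi_injective (h : IsParityPartition ν Φp Φm) : Function.Injective (Psi Φp Φm) := by
  rintro (ρ | φ) (ρ' | φ') heq
  · by_contra hne
    obtain ⟨φ, hφ, hρ, hρ'⟩ := h.exists_mem_notMem (x := ρ) (y := ρ') (fun he => hne (he ▸ rfl))
    have := Finset.ext_iff.1 heq φ
    simp [Psi, hφ, hρ, hρ'] at this
  · exact absurd heq (h.psi_inl_ne_psi_inr ρ φ')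
  · exact absurd heq.symm (h.psi_inl_ne_psi_inr ρ' φ)
  · by_contra hne
    obtain ⟨ψ, hψ, h₃, h₁⟩ :=
      h.exists_card_inter φ.2 φ'.2 (fun he => hne (congrArg Sum.inr (Subtype.ext he)))
    have := Finset.ext_iff.1 heq ψ
    simp [Psi, hψ, h₃, h₁] at this

theorem card_of_isSectionOf (h : IsParityPartition ν Φp Φm) {T : Finset (Finset X)}
    (hT : IsSectionOf Φp T) : T.card = 4 := by
  have himage : T.image compl = Φp \ T := by
    ext φ
    rw [Finset.mem_image, Finset.mem_sdiff]
    constructor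
    · rintro ⟨ψ, hψ, rfl⟩
      exact ⟨h.compl_left ψ (hT.1 hψ), (hT.2 ψ (hT.1 hψ)).1 hψ⟩
    · rintro ⟨hφ, hφT⟩
      exact ⟨φᶜ, by_contra fun hc => hφT ((hT.2 φ hφ).2 hc), compl_compl φ⟩
  have hcard := Finset.card_image_of_injective T (compl_injective (α := Finset X))
  rw [himage] at hcard
  have := Finset.card_sdiff_add_card_eq_card hT.1
  have := h.card_left
  lia

theorem exists_psi_eq (h : IsParityPartition ν Φp Φm) (S : Finset (Finset X))
    (hS : IsSectionOf Φp S) : ∃ z, Psi Φp Φm z = S := by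
  have hcardS := h.card_of_isSectionOf hS
  let trace : X ⊕ {φ : Finset X // φ ∈ Φm} → S.powerset := fun z =>
    ⟨Psi Φp Φm z ∩ S, Finset.mem_powerset.2 Finset.inter_subset_right⟩
  have hinj : Function.Injective trace := fun z z' hz =>
    h.psi_injective ((h.isSectionOf_psi z).eq_of_inter_eq hS (h.isSectionOf_psi z')
      (congrArg Subtype.val hz))
  have hbij : Function.Bijective trace := by
    rw [Fintype.bijective_iff_injective_and_card]
    refine ⟨hinj, ?_⟩
    rw [Fintype.card_sum, Fintype.card_coe, Fintype.card_coe, Finset.card_powerset, h.card_eq,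
      h.card_right, hcardS]
    norm_num
  obtain ⟨z, hz⟩ := hbij.2 ⟨S, Finset.mem_powerset_self S⟩
  refine ⟨z, (h.isSectionOf_psi z).eq_of_inter_eq hS hS ?_⟩
  rw [Finset.inter_self]
  exact congrArg Subtype.val hz

end IsParityPartition

variable {Φp Φm : Finset (Finset X)}

theorem image_psi_inl (g : X ≃ X) (hg : ∀ φ ∈ Φp, φ.image ⇑g ∈ Φp) (ρ : X) :
    (Psi Φp Φm (Sum.inl ρ)).image (fun φ => φ.image ⇑g) = Psi Φp Φm (Sum.inl (g ρ)) :=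
  image_filter_of_image_iff g hg _ _ fun _ => g.injective.mem_finset_image

theorem image_psi_inr (g : X ≃ X) (hg : ∀ φ ∈ Φp, φ.image ⇑g ∈ Φp)
    (φ' : {φ : Finset X // φ ∈ Φm}) (h : φ'.1.image ⇑g ∈ Φm) :
    (Psi Φp Φm (Sum.inr φ')).image (fun φ => φ.image ⇑g)
      = Psi Φp Φm (Sum.inr ⟨φ'.1.image ⇑g, h⟩) :=
  image_filter_of_image_iff g hg _ _ fun φ => by
    rw [← Finset.image_inter _ _ g.injective, Finset.card_image_of_injective _ g.injective]

end Reflex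

/-- With `X` an 8-element set with fixed-point-free involution `ν` and
`Φ = Φ⁺ ⊔ Φ⁻` the parity partition of its 16 sections, the map `Ψ : X ⊔ Φ⁻ →
Sections(Φ⁺, complement)` is a well-defined bijection, equivariant for any permutation of
`X` commuting with `ν` whose induced action preserves `Φ⁺`; and the analogous statement
holds with the roles of `Φ⁺` and `Φ⁻` interchanged. -/
theorem stmt14 (X : Type*) [Fintype X] [DecidableEq X]
    (hX : Fintype.card X = 8)
    (ν : X → X) (hν2 : ∀ x, ν (ν x) = x) (hνfp : ∀ x, ν x ≠ x)
    (Φp Φm : Finset (Finset X))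
    (hΦp : Φp.card = 8) (hΦm : Φm.card = 8) (hdisj : Disjoint Φp Φm)
    (hsec : ∀ φ : Finset X, IsSection ν φ ↔ (φ ∈ Φp ∨ φ ∈ Φm))
    (hpp : ∀ φ ∈ Φp, ∀ φ' ∈ Φp, Even (φ ∩ φ').card)
    (hmm : ∀ φ ∈ Φm, ∀ φ' ∈ Φm, Even (φ ∩ φ').card)
    (hpm : ∀ φ ∈ Φp, ∀ φ' ∈ Φm, ¬ Even (φ ∩ φ').card)
    (hcp : ∀ φ ∈ Φp, φᶜ ∈ Φp) (hcm : ∀ φ ∈ Φm, φᶜ ∈ Φm) :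
    -- `Ψ` is well defined: its values are sections of `(Φ⁺, complement)`
    (∀ z, IsSectionOf Φp (Psi Φp Φm z)) ∧
    -- `Ψ` is a bijection onto the set of sections of `(Φ⁺, complement)`
    Function.Injective (Psi Φp Φm) ∧
    (∀ S : Finset (Finset X), IsSectionOf Φp S → ∃ z, Psi Φp Φm z = S) ∧
    -- `Ψ` is equivariant for permutations of `X` commuting with `ν` preserving `Φ⁺`
    (∀ g : X ≃ X, (∀ x, g (ν x) = ν (g x)) → (∀ φ ∈ Φp, φ.image ⇑g ∈ Φp) →
      (∀ ρ : X, (Psi Φp Φm (Sum.inl ρ)).image (fun φ => φ.image ⇑g)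
          = Psi Φp Φm (Sum.inl (g ρ))) ∧
      (∀ (φ' : {φ : Finset X // φ ∈ Φm}) (h : φ'.1.image ⇑g ∈ Φm),
        (Psi Φp Φm (Sum.inr φ')).image (fun φ => φ.image ⇑g)
          = Psi Φp Φm (Sum.inr ⟨φ'.1.image ⇑g, h⟩))) ∧
    -- the analogous statement with `Φ⁺` and `Φ⁻` interchanged
    ((∀ z, IsSectionOf Φm (Psi Φm Φp z)) ∧
      Function.Injective (Psi Φm Φp) ∧
      (∀ S : Finset (Finset X), IsSectionOf Φm S → ∃ z, Psi Φm Φp z = S) ∧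
      (∀ g : X ≃ X, (∀ x, g (ν x) = ν (g x)) → (∀ φ ∈ Φm, φ.image ⇑g ∈ Φm) →
        (∀ ρ : X, (Psi Φm Φp (Sum.inl ρ)).image (fun φ => φ.image ⇑g)
            = Psi Φm Φp (Sum.inl (g ρ))) ∧
        (∀ (φ' : {φ : Finset X // φ ∈ Φp}) (h : φ'.1.image ⇑g ∈ Φp),
          (Psi Φm Φp (Sum.inr φ')).image (fun φ => φ.image ⇑g)
            = Psi Φm Φp (Sum.inr ⟨φ'.1.image ⇑g, h⟩)))) := by
  have h : IsParityPartition ν Φp Φm :=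
    ⟨hX, hν2, hνfp, hΦp, hΦm, hsec, hpp, hmm, hpm, hcp, hcm⟩
  exact ⟨h.isSectionOf_psi, h.psi_injective, h.exists_psi_eq,
    fun g _ hg => ⟨image_psi_inl g hg, image_psi_inr g hg⟩,
    h.symm.isSectionOf_psi, h.symm.psi_injective, h.symm.exists_psi_eq,
    fun g _ hg => ⟨image_psi_inl g hg, image_psi_inr g hg⟩⟩
end

section
/- For all ρ ∈ X, φ₊ ∈ Φ+ and φ₋ ∈ Φ−: (i) ρ ∈ φ₊ if and only if |τ(ρ) ∩ τ(φ₊)| = 1, and ρ ∉ φ₊ if and only if |τ(ρ) ∩ τ(φ₊)| = 3; (ii) ρ ∈ φ₋ if and only if τ(φ₋) ∈ τ(ρ); (iii) |φ₊ ∩ φ₋| = 1 if and only if τ(φ₋) ∈ τ(φ₊), and |φ₊ ∩ φ₋| = 3 if and only if τ(φ₋) ∉ τ(φ₊). Consequently, φ₊ ∩ φ₋ = {ρ} if and only if τ(ρ) ∩ τ(φ₊) = {τ(φ₋)}. -/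
/-- `S = {1,2,3,4}` as a finite set of integers. -/
def S4 : Finset ℤ := {1, 2, 3, 4}

/-- `X = {1,2,3,4,−1,−2,−3,−4} ⊆ ℤ`, carrying the fixed-point-free involution `x ↦ −x`. -/
def Xset : Finset ℤ := {1, 2, 3, 4, -1, -2, -3, -4}

/-- For `T ⊆ S`, the section `φ_T = {t : t ∈ T} ∪ {−t : t ∈ S ∖ T}` of `(X, x ↦ −x)`. -/
def secOf (T : Finset ℤ) : Finset ℤ := T ∪ (S4 \ T).image (fun t => -t)

/-- The triality map `τ` on `X`:  `τ(1)=φ_{1}, τ(2)=φ_{134}, τ(3)=φ_{124}, τ(4)=φ_{123},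
τ(−1)=φ_{234}, τ(−2)=φ_{2}, τ(−3)=φ_{3}, τ(−4)=φ_{4}`. -/
def tau1 (x : ℤ) : Finset ℤ :=
  if x = 1 then secOf {1} else if x = 2 then secOf {1, 3, 4}
  else if x = 3 then secOf {1, 2, 4} else if x = 4 then secOf {1, 2, 3}
  else if x = -1 then secOf {2, 3, 4} else if x = -2 then secOf {2}
  else if x = -3 then secOf {3} else if x = -4 then secOf {4} else ∅

/-- The triality map `τ` on `Φ+`:  `τ(φ_{1})=φ_{1234}, τ(φ_{134})=φ_{34}, τ(φ_{124})=φ_{24},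
τ(φ_{123})=φ_{23}, τ(φ_{234})=φ_{∅}, τ(φ_{2})=φ_{12}, τ(φ_{3})=φ_{13}, τ(φ_{4})=φ_{14}`. -/
def tau2 (φ : Finset ℤ) : Finset ℤ :=
  if φ = secOf {1} then secOf {1, 2, 3, 4} else if φ = secOf {1, 3, 4} then secOf {3, 4}
  else if φ = secOf {1, 2, 4} then secOf {2, 4} else if φ = secOf {1, 2, 3} then secOf {2, 3}
  else if φ = secOf {2, 3, 4} then secOf ∅ else if φ = secOf {2} then secOf {1, 2}
  else if φ = secOf {3} then secOf {1, 3} else if φ = secOf {4} then secOf {1, 4} else ∅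

/-- The triality map `τ` on `Φ−`:  `τ(φ_{1234})=1, τ(φ_{34})=2, τ(φ_{24})=3, τ(φ_{23})=4,
τ(φ_{∅})=−1, τ(φ_{12})=−2, τ(φ_{13})=−3, τ(φ_{14})=−4`. -/
def tau3 (φ : Finset ℤ) : ℤ :=
  if φ = secOf {1, 2, 3, 4} then 1 else if φ = secOf {3, 4} then 2
  else if φ = secOf {2, 4} then 3 else if φ = secOf {2, 3} then 4
  else if φ = secOf ∅ then -1 else if φ = secOf {1, 2} then -2
  else if φ = secOf {1, 3} then -3 else if φ = secOf {1, 4} then -4 else 0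

theorem eq_singleton_iff_card_eq_one_and_mem {α : Type*} (A : Finset α) (a : α) :
    A = {a} ↔ A.card = 1 ∧ a ∈ A := by
  constructor
  · rintro rfl
    simp
  · rintro ⟨hA, ha⟩
    obtain ⟨b, rfl⟩ := Finset.card_eq_one.mp hA
    rw [Finset.mem_singleton.mp ha]

/-- The map `τ` exchanges the incidence relations between `X`, `Φ+` and `Φ−`. -/
theorem incidence_iff_tau :
    (∀ ρ ∈ Xset, ∀ Tp ∈ S4.powerset, Odd Tp.card →
      ((ρ ∈ secOf Tp ↔ (tau1 ρ ∩ tau2 (secOf Tp)).card = 1) ∧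
        (ρ ∉ secOf Tp ↔ (tau1 ρ ∩ tau2 (secOf Tp)).card = 3))) ∧
    (∀ ρ ∈ Xset, ∀ Tm ∈ S4.powerset, Even Tm.card →
      (ρ ∈ secOf Tm ↔ tau3 (secOf Tm) ∈ tau1 ρ)) ∧
    (∀ Tp ∈ S4.powerset, Odd Tp.card → ∀ Tm ∈ S4.powerset, Even Tm.card →
      (((secOf Tp ∩ secOf Tm).card = 1 ↔ tau3 (secOf Tm) ∈ tau2 (secOf Tp)) ∧
        ((secOf Tp ∩ secOf Tm).card = 3 ↔ tau3 (secOf Tm) ∉ tau2 (secOf Tp)))) := by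
  decide +kernel

/-- For all `ρ ∈ X`, `φ₊ ∈ Φ+` (i.e. `φ₊ = φ_T` with `T ⊆ S`, `|T|` odd)
and `φ₋ ∈ Φ−` (i.e. `φ₋ = φ_T` with `|T|` even):
(i) `ρ ∈ φ₊ ↔ |τ(ρ) ∩ τ(φ₊)| = 1` and `ρ ∉ φ₊ ↔ |τ(ρ) ∩ τ(φ₊)| = 3`;
(ii) `ρ ∈ φ₋ ↔ τ(φ₋) ∈ τ(ρ)` (and the negated version);
(iii) `|φ₊ ∩ φ₋| = 1 ↔ τ(φ₋) ∈ τ(φ₊)` and `|φ₊ ∩ φ₋| = 3 ↔ τ(φ₋) ∉ τ(φ₊)`.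
Consequently, `φ₊ ∩ φ₋ = {ρ}` iff `τ(ρ) ∩ τ(φ₊) = {τ(φ₋)}`. -/
theorem stmt15 (ρ : ℤ) (hρ : ρ ∈ Xset)
    (Tp : Finset ℤ) (hTp : Tp ⊆ S4) (hTpodd : Odd Tp.card)
    (Tm : Finset ℤ) (hTm : Tm ⊆ S4) (hTmeven : Even Tm.card) :
    ((ρ ∈ secOf Tp ↔ (tau1 ρ ∩ tau2 (secOf Tp)).card = 1) ∧
      (ρ ∉ secOf Tp ↔ (tau1 ρ ∩ tau2 (secOf Tp)).card = 3)) ∧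
    ((ρ ∈ secOf Tm ↔ tau3 (secOf Tm) ∈ tau1 ρ) ∧
      (ρ ∉ secOf Tm ↔ tau3 (secOf Tm) ∉ tau1 ρ)) ∧
    (((secOf Tp ∩ secOf Tm).card = 1 ↔ tau3 (secOf Tm) ∈ tau2 (secOf Tp)) ∧
      ((secOf Tp ∩ secOf Tm).card = 3 ↔ tau3 (secOf Tm) ∉ tau2 (secOf Tp))) ∧
    (secOf Tp ∩ secOf Tm = {ρ} ↔ tau1 ρ ∩ tau2 (secOf Tp) = {tau3 (secOf Tm)}) := by
  obtain ⟨h₁, h₂, h₃⟩ := incidence_iff_tau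
  rw [← Finset.mem_powerset] at hTp hTm
  have hp := h₁ ρ hρ Tp hTp hTpodd
  have hm := h₂ ρ hρ Tm hTm hTmeven
  have hpm := h₃ Tp hTp hTpodd Tm hTm hTmeven
  refine ⟨hp, ⟨hm, not_congr hm⟩, hpm, ?_⟩
  rw [eq_singleton_iff_card_eq_one_and_mem, eq_singleton_iff_card_eq_one_and_mem, Finset.mem_inter,
    Finset.mem_inter, hpm.1, ← hp.1, ← hm]
  tauto
end
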